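/- arXiv:1305.4386 — 2 statements merged into one kernel-verified Lean document; each statement's English description precedes it below -/
import Mathlib

section
/- Let G ⊂ ℂ be a bounded Jordan domain (the bounded connected component of the complement of the image of an injective continuous map of the unit circle into ℂ). If g ∈ B₂(G) and the Cauchy transform (Kg)(ζ) = (1/π)∬_G conj(g(z))/(z−ζ) dx dy vanishes for every ζ ∈ ℂ∖cl(G), then g = 0. In other words, the Cauchy transform K is injective on B₂(G). -/
open Complex MeasureTheory Metric Set Filter Bornology

/-- A Jordan curve: the image of an injective continuous map of the unit circle into `ℂ`. -/
def IsJordanCurve (J : Set ℂ) : Prop :=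
  ∃ f : ℂ → ℂ, ContinuousOn f (Metric.sphere 0 1) ∧
    Set.InjOn f (Metric.sphere 0 1) ∧ J = f '' Metric.sphere 0 1

/-- A Jordan domain: a bounded connected component of the complement of a Jordan curve. -/
def IsJordanDomain (G : Set ℂ) : Prop :=
  ∃ J : Set ℂ, IsJordanCurve J ∧ Bornology.IsBounded G ∧
    ∃ z ∈ Jᶜ, G = connectedComponentIn Jᶜ z

/-- Membership in the Bergman space `B₂(G)`: holomorphic with square-integrable modulus. -/
def MemB2 (G : Set ℂ) (g : ℂ → ℂ) : Prop :=
  DifferentiableOn ℂ g G ∧ IntegrableOn (fun z => ‖g z‖ ^ 2) G volume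

/-- The Cauchy transform `(Kg)(ζ) = (1/π) ∬_G conj (g z) / (z - ζ) dx dy`. -/
noncomputable def cauchyTransform (G : Set ℂ) (g : ℂ → ℂ) (ζ : ℂ) : ℂ :=
  (1 / Real.pi : ℂ) * ∫ z in G, (starRingEnd ℂ) (g z) / (z - ζ) ∂volume

section Topology

/-- There is no continuous branch of `log (z - p)` on a circle around `p`. -/
theorem not_exp_eq_sub_on_sphere {Λ : ℂ → ℂ} (hΛ : Continuous Λ) (p : ℂ) {R : ℝ} (hR : 0 < R)
    (h : ∀ z ∈ sphere p R, exp (Λ z) = z - p) : False := by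
  let k : ℝ → ℂ := fun t => Λ (circleMap p R t) - t * I
  have hk : Continuous k := by
    have := continuous_circleMap p R
    fun_prop
  have hexp : ∀ t, exp (k t) = R := by
    intro t
    have h1 := h _ (circleMap_mem_sphere p hR.le t)
    simp only [k, exp_sub, h1, circleMap_sub_center]
    simp [circleMap]
  have hc := isCoveringMap_exp.const_of_comp (g := k) hk
    (fun a a' => Subtype.ext (by simp [hexp])) 0 (2 * Real.pi)
  have h2 : circleMap p R (2 * Real.pi) = circleMap p R 0 := by
    simp [circleMap]
  simp only [k, h2] at hc
  have : (Real.pi : ℂ) ≠ 0 := by exact_mod_cast Real.pi_ne_zero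
  simp only [ofReal_zero, zero_mul, sub_zero] at hc
  have h3 : (2 * Real.pi : ℂ) * I = 0 := by
    push_cast at hc
    linear_combination hc
  simp [this] at h3

/-- A nonempty bounded set disjoint from a simple arc does not have its frontier in the arc. -/
theorem Bornology.IsBounded.eq_empty_of_frontier_subset_arc {W : Set ℂ} (hb : IsBounded W)
    {e : unitInterval → ℂ} (he : Continuous e) (hinj : Function.Injective e)
    (hfr : frontier W ⊆ range e) (hd : Disjoint W (range e)) : W = ∅ := by
  classical
  by_contra hne
  obtain ⟨p, hp⟩ := Set.nonempty_iff_ne_empty.2 hne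
  have hpe : ∀ t, e t - p ≠ 0 := fun t ht =>
    Set.disjoint_left.1 hd hp ⟨t, sub_eq_zero.1 ht⟩
  have hemb : Topology.IsClosedEmbedding e := he.isClosedEmbedding hinj
  -- a continuous logarithm on the arc
  obtain ⟨l, hl⟩ : ∃ l : C(unitInterval, ℂ), ∀ t, exp (l t) = e t - p := by
    let γ : C(unitInterval, {z : ℂ // z ≠ 0}) := ⟨fun t => ⟨e t - p, hpe t⟩, by fun_prop⟩
    have h0 : γ 0 = (fun z : ℂ ↦ (⟨_, z.exp_ne_zero⟩ : {z : ℂ // z ≠ 0})) (log (e 0 - p)) :=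
      Subtype.ext (exp_log (hpe 0)).symm
    refine ⟨isCoveringMap_exp.liftPath γ _ h0, fun t => ?_⟩
    have := congrFun (isCoveringMap_exp.liftPath_lifts γ _ h0) t
    exact congrArg Subtype.val this
  obtain ⟨F, hF⟩ := ContinuousMap.exists_extension hemb l
  have hF' : ∀ z ∈ range e, exp (F z) = z - p := by
    rintro _ ⟨t, rfl⟩
    rw [← hl t, ← hF]; rfl
  -- glue with `z - p` outside `W`
  let H : ℂ → ℂ := fun z => if z ∈ W then exp (F z) else z - p
  have hH : Continuous H := by
    refine continuous_if (fun a ha => hF' a (hfr ha)) ?_ ?_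
    · exact (Complex.continuous_exp.comp F.continuous).continuousOn
    · exact (continuous_id.sub continuous_const).continuousOn
  have hH0 : ∀ z, H z ∈ ({0}ᶜ : Set ℂ) := by
    intro z
    by_cases hz : z ∈ W
    · simp [H, hz]
    · simp only [H, hz, if_false, mem_compl_iff, mem_singleton_iff, sub_eq_zero]
      rintro rfl; exact hz hp
  obtain ⟨Λ, ⟨-, hΛ⟩, -⟩ := isCoveringMapOn_exp.existsUnique_continuousMap_lifts ⟨H, hH⟩
    (a₀ := 0) (e₀ := log (H 0)) (exp_log (hH0 0)) hH0
  obtain ⟨R, hR0, hR⟩ := hb.subset_ball_lt 0 p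
  refine not_exp_eq_sub_on_sphere Λ.continuous p hR0 fun z hz => ?_
  have hzW : z ∉ W := fun hzW => by
    have := hR hzW
    rw [mem_ball] at this; rw [mem_sphere] at hz; linarith
  have := congrFun hΛ z
  simpa [H, hzW] using this

/-- Removing a small neighbourhood of a point from a Jordan curve leaves a set contained in a
simple arc of the curve avoiding the point. -/
theorem IsJordanCurve.exists_arc {J : Set ℂ} (hJ : IsJordanCurve J) {x : ℂ} (hx : x ∈ J)
    {U : Set ℂ} (hU : IsOpen U) (hxU : x ∈ U) :
    ∃ e : unitInterval → ℂ, Continuous e ∧ Function.Injective e ∧ J \ U ⊆ range e ∧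
      x ∉ range e ∧ range e ⊆ J := by
  obtain ⟨f, hf, hinj, rfl⟩ := hJ
  obtain ⟨w, hw, rfl⟩ := hx
  have hw1 : ‖w‖ = 1 := by simpa using hw
  have hw0 : w ≠ 0 := by rintro rfl; simp at hw1
  let c : ℝ → ℂ := fun θ => w * exp (θ * I)
  have hcc : Continuous c := by fun_prop
  have hcs : ∀ θ, c θ ∈ sphere (0 : ℂ) 1 := fun θ => by
    simp [c, hw1, Complex.norm_exp_ofReal_mul_I]
  have hfc : Continuous (fun θ => f (c θ)) := hf.comp_continuous hcc hcs
  have h0 : c 0 = w := by simp [c]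
  have hnear : ∀ᶠ θ in nhds (0 : ℝ), f (c θ) ∈ U :=
    hfc.continuousAt.eventually_mem (hU.mem_nhds (by simpa [h0] using hxU))
  obtain ⟨η, hη, hηU⟩ := Metric.eventually_nhds_iff.1 hnear
  obtain ⟨r, hr0, hrη, hr1⟩ : ∃ r, 0 < r ∧ r < η ∧ r < 1 :=
    ⟨min η 1 / 2, by positivity, by have := min_le_left η 1; linarith [lt_min hη one_pos],
      by have := min_le_right η 1; linarith [lt_min hη one_pos]⟩
  have hpi := Real.pi_gt_three
  have hcinj : ∀ s t : ℝ, |s - t| < 2 * Real.pi → f (c s) = f (c t) → s = t := by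
    intro s t hst h
    have h1 := mul_left_cancel₀ hw0 (hinj (hcs s) (hcs t) h)
    rw [Complex.exp_eq_exp_iff_exists_int] at h1
    obtain ⟨n, hn⟩ := h1
    have h2 : s = t + n * (2 * Real.pi) := by
      have := congrArg Complex.im hn
      simpa using this
    have h3 : s - t = n * (2 * Real.pi) := by linarith
    rw [h3, abs_mul, abs_of_pos Real.two_pi_pos] at hst
    have h4 : |(n : ℝ)| < 1 := by nlinarith [Real.two_pi_pos]
    have h5 : n = 0 := by
      have : |n| < 1 := by exact_mod_cast h4
      exact Int.abs_lt_one_iff.1 this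
    simp [h2, h5]
  let a : unitInterval → ℝ := fun t => r + t * (2 * Real.pi - 2 * r)
  have ha : ∀ t, r ≤ a t ∧ a t ≤ 2 * Real.pi - r := fun t => by
    have := t.2.1; have := t.2.2
    constructor <;> simp only [a] <;> nlinarith
  have hmem : ∀ θ, r ≤ θ → θ ≤ 2 * Real.pi - r → ∃ t, a t = θ := by
    intro θ h1 h2
    have hp : 0 < 2 * Real.pi - 2 * r := by linarith
    refine ⟨⟨(θ - r) / (2 * Real.pi - 2 * r), by apply div_nonneg <;> linarith, ?_⟩, ?_⟩
    · rw [div_le_one hp]; linarith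
    · simp only [a]; rw [div_mul_cancel₀ _ hp.ne']; ring
  refine ⟨fun t => f (c (a t)), hfc.comp (by fun_prop), ?_, ?_, ?_, ?_⟩
  · intro s t hst
    have h1 := ha s; have h2 := ha t
    have h3 := hcinj _ _ (by rw [abs_lt]; constructor <;> linarith) hst
    have hp : 0 < 2 * Real.pi - 2 * r := by linarith
    simp only [a] at h3
    exact Subtype.ext (mul_right_cancel₀ hp.ne' (by linarith))
  · rintro _ ⟨⟨v, hv, rfl⟩, hvU⟩
    have hv1 : ‖v‖ = 1 := by simpa using hv
    obtain ⟨θ, hθ1, hθ2, rfl⟩ : ∃ θ : ℝ, -Real.pi < θ ∧ θ ≤ Real.pi ∧ c θ = v := by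
      refine ⟨arg (v / w), neg_pi_lt_arg _, arg_le_pi _, ?_⟩
      have := norm_mul_exp_arg_mul_I (v / w)
      rw [norm_div, hv1, hw1] at this
      simp only [c]
      rw [show exp (arg (v / w) * I) = v / w by simpa using this]
      field_simp
    have hθ : r ≤ |θ| := by
      by_contra hlt
      push Not at hlt
      exact hvU (hηU (by simpa [Real.dist_eq] using hlt.trans hrη))
    rcases le_abs.1 hθ with h | h
    · obtain ⟨t, ht⟩ := hmem θ h (by linarith)
      exact ⟨t, by simp only [ht]⟩
    · obtain ⟨t, ht⟩ := hmem (θ + 2 * Real.pi) (by linarith) (by linarith)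
      refine ⟨t, ?_⟩
      simp only [ht]
      congr 1
      simp [c, add_mul, exp_add]
  · rintro ⟨t, ht⟩
    have h1 := ha t
    have := hcinj (a t) 0 (by rw [abs_lt]; constructor <;> linarith) (by simpa [h0] using ht)
    linarith
  · rintro _ ⟨t, rfl⟩
    exact ⟨_, hcs _, rfl⟩

theorem IsJordanCurve.isCompact {J : Set ℂ} (hJ : IsJordanCurve J) : IsCompact J := by
  obtain ⟨f, hf, -, rfl⟩ := hJ
  exact (isCompact_sphere 0 1).image_of_continuousOn hf

theorem isPreconnected_setOf_le_norm (R : ℝ) :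
    IsPreconnected {z : ℂ | R ≤ ‖z‖} := by
  have h : {z : ℂ | R ≤ ‖z‖} =
      (fun q : ℝ × ℝ => (q.1 : ℂ) * exp (q.2 * I)) '' (Ici R ×ˢ univ) := by
    ext z
    constructor
    · intro hz
      exact ⟨(‖z‖, arg z), ⟨hz, mem_univ _⟩, norm_mul_exp_arg_mul_I z⟩
    · rintro ⟨q, ⟨hq, -⟩, rfl⟩
      have hq : R ≤ q.1 := hq
      simpa [Complex.norm_exp_ofReal_mul_I] using hq.trans (le_abs_self _)
  rw [h]
  refine (isPreconnected_Ici.prod isPreconnected_univ).image _ ?_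
  exact Continuous.continuousOn (by fun_prop)

/-- A Jordan domain comes with an exterior domain: an open connected set, disjoint from it,
containing a neighbourhood of infinity, and adherent to every boundary point. -/
theorem IsJordanDomain.exists_exterior {G : Set ℂ} (hG : IsJordanDomain G) :
    IsOpen G ∧ IsBounded G ∧ ∃ Ω : Set ℂ, IsOpen Ω ∧ IsConnected Ω ∧ Disjoint G Ω ∧
      (∃ R > 0, ∀ z : ℂ, R ≤ ‖z‖ → z ∈ Ω) ∧ frontier G ⊆ closure Ω := by
  obtain ⟨J, hJ, hGb, z₀, hz₀, rfl⟩ := hG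
  have hJc := hJ.isCompact
  have hJo : IsOpen Jᶜ := hJc.isClosed.isOpen_compl
  obtain ⟨R, hR0, hR⟩ := hJc.isBounded.subset_ball_lt 0 0
  have hRJ : {z : ℂ | R ≤ ‖z‖} ⊆ Jᶜ := fun z hz hzJ => by
    have := hR hzJ
    rw [mem_ball_zero_iff] at this
    exact absurd this (not_lt.2 hz)
  have hRm : (R : ℂ) ∈ {z : ℂ | R ≤ ‖z‖} := by simp [abs_of_pos hR0]
  let Ω := connectedComponentIn Jᶜ (R : ℂ)
  have hΩR : {z : ℂ | R ≤ ‖z‖} ⊆ Ω :=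
    (isPreconnected_setOf_le_norm R).subset_connectedComponentIn hRm hRJ
  have hΩo : IsOpen Ω := hJo.connectedComponentIn
  have hfr : ∀ y, frontier (connectedComponentIn Jᶜ y) ⊆ J := by
    intro y x hx
    by_contra hxJ
    have hxo : IsOpen (connectedComponentIn Jᶜ x) := hJo.connectedComponentIn
    obtain ⟨v, hv1, hv2⟩ := mem_closure_iff.1 hx.1 _ hxo (mem_connectedComponentIn hxJ)
    have h1 := connectedComponentIn_eq hv1
    have h2 := connectedComponentIn_eq hv2
    have : x ∈ connectedComponentIn Jᶜ y := by
      rw [h2, ← h1]; exact mem_connectedComponentIn hxJ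
    rw [hJo.connectedComponentIn.frontier_eq] at hx
    exact hx.2 this
  refine ⟨hJo.connectedComponentIn, hGb, Ω, hΩo,
    isConnected_connectedComponentIn_iff.2 (hRJ hRm), ?_, ⟨R, hR0, fun z hz => hΩR hz⟩, ?_⟩
  · rw [Set.disjoint_left]
    intro v hv1 hv2
    have h : connectedComponentIn Jᶜ z₀ = Ω :=
      (connectedComponentIn_eq hv1).trans (connectedComponentIn_eq hv2).symm
    rw [h] at hGb
    obtain ⟨M, hM0, hM⟩ := hGb.subset_ball_lt 0 0
    have h3 : ((max R M : ℝ) : ℂ) ∈ Ω := hΩR (by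
      simpa using (le_max_left R M).trans (le_abs_self _))
    have h4 := hM h3
    rw [mem_ball_zero_iff] at h4
    simp only [norm_real, Real.norm_eq_abs] at h4
    have := le_abs_self (max R M)
    have := le_max_right R M
    linarith
  · intro x hx
    by_contra hxΩ
    have hxJ : x ∈ J := hfr _ hx
    obtain ⟨e, he, hinj, hJe, hxe, heJ⟩ :=
      hJ.exists_arc hxJ isClosed_closure.isOpen_compl hxΩ
    have hec : IsClosed (range e) := (isCompact_range he).isClosed
    let W := (closure Ω)ᶜ \ range e
    have hWo : IsOpen W := isClosed_closure.isOpen_compl.sdiff hec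
    have hWe : W = ∅ := by
      have hWb : W ⊆ ball 0 R := fun v hv => by
        rw [mem_ball_zero_iff]
        by_contra hle
        exact hv.1 (subset_closure (hΩR (not_lt.1 hle)))
      refine (isBounded_ball.subset hWb).eq_empty_of_frontier_subset_arc he hinj ?_ ?_
      · intro v hv
        rw [hWo.frontier_eq] at hv
        by_contra hve
        have hvΩ : v ∈ closure Ω := by
          by_contra hvn
          exact hv.2 ⟨hvn, hve⟩
        have hvn : v ∉ Ω := fun hvo => by
          obtain ⟨y, hy1, hy2⟩ := mem_closure_iff.1 hv.1 _ hΩo hvo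
          exact hy2.1 (subset_closure hy1)
        have hvJ : v ∈ J := hfr (R : ℂ) (by rw [hΩo.frontier_eq]; exact ⟨hvΩ, hvn⟩)
        exact hve (hJe ⟨hvJ, not_not.2 hvΩ⟩)
      · exact disjoint_sdiff_left
    exact (hWe ▸ (⟨hxΩ, hxe⟩ : x ∈ W) : x ∈ (∅ : Set ℂ))

end Topology

section Kernel

/-- The Wirtinger derivative `∂f/∂z̄`. -/
noncomputable def dbar (f : ℂ → ℂ) (z : ℂ) : ℂ :=
  (1 / 2) * (fderiv ℝ f z 1 + I * fderiv ℝ f z I)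

/-- A smooth regularisation of the Cauchy kernel `1 / (π z)`, unchanged for `ε ≤ ‖z‖`, whose
`∂/∂z̄` derivative is a probability density. -/
theorem exists_smooth_cauchyKernel {ε : ℝ} (hε : 0 < ε) :
    ∃ (K : ℂ → ℂ) (ρ : ℂ → ℝ), ContDiff ℝ 2 K ∧ (∀ z, dbar K z = ρ z) ∧
      (∀ z, ε ≤ ‖z‖ → K z = 1 / (Real.pi * z)) ∧ Continuous ρ ∧ (∀ z, 0 ≤ ρ z) ∧
      (∀ z, ε < ‖z‖ → ρ z = 0) ∧ ∫ z, ρ z = 1 := by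
  let q : ℝ → ℝ := fun t => Real.smoothTransition (2 * (t / ε ^ 2) - 1)
  have hq : ContDiff ℝ 3 q := Real.smoothTransition.contDiff.comp (by fun_prop)
  have hq' : Continuous (deriv q) := hq.continuous_deriv (by norm_num)
  have hqd : Differentiable ℝ q := hq.differentiable (by norm_num)
  have hqm : Monotone q := fun s t hst => Real.smoothTransition.monotone (by gcongr)
  have hq0 : ∀ t, t ≤ ε ^ 2 / 2 → q t = 0 := fun t ht =>
    Real.smoothTransition.zero_of_nonpos (by
      have : t / ε ^ 2 ≤ 1 / 2 := by rw [div_le_iff₀ (by positivity)]; linarith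
      linarith)
  have hq1 : ∀ t, ε ^ 2 ≤ t → q t = 1 := fun t ht =>
    Real.smoothTransition.one_of_one_le (by
      have : 1 ≤ t / ε ^ 2 := by rw [le_div_iff₀ (by positivity)]; linarith
      linarith)
  have hdq1 : ∀ t, ε ^ 2 < t → deriv q t = 0 := fun t ht => by
    have : q =ᶠ[nhds t] fun _ => 1 := by
      filter_upwards [lt_mem_nhds ht] with s hs using hq1 s hs.le
    rw [this.deriv_eq, deriv_const]
  have hpi : (Real.pi : ℂ) ≠ 0 := by exact_mod_cast Real.pi_ne_zero
  let K : ℂ → ℂ := fun z => (q (‖z‖ ^ 2) : ℂ) * (1 / (Real.pi * z))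
  have hns : ContDiff ℝ 3 fun z : ℂ => ‖z‖ ^ 2 := contDiff_norm_sq ℝ
  have hK0 : K =ᶠ[nhds 0] fun _ => 0 := by
    have : ∀ᶠ z : ℂ in nhds 0, ‖z‖ ^ 2 < ε ^ 2 / 2 :=
      (hns.continuous.continuousAt (x := (0:ℂ))).eventually_lt continuousAt_const (by
        simp; positivity)
    filter_upwards [this] with z hz
    simp [K, hq0 _ hz.le]
  refine ⟨K, fun z => deriv q (‖z‖ ^ 2) / Real.pi, ?_, ?_, ?_, ?_, ?_, ?_, ?_⟩
  · rw [contDiff_iff_contDiffAt]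
    intro z
    by_cases hz : z = 0
    · subst hz
      exact contDiffAt_const.congr_of_eventuallyEq hK0
    · refine ContDiffAt.mul ?_ ?_
      · exact (ofRealCLM.contDiff.comp ((hq.of_le (by norm_num)).comp
          (hns.of_le (by norm_num)))).contDiffAt
      · simp only [one_div]
        exact ContDiffAt.inv (𝕜 := ℝ) (contDiffAt_const.mul contDiffAt_id) (mul_ne_zero hpi hz)
  · intro z
    by_cases hz : z = 0
    · subst hz
      have : deriv q 0 = 0 := by
        have : q =ᶠ[nhds 0] fun _ => 0 := by
          filter_upwards [gt_mem_nhds (show (0 : ℝ) < ε ^ 2 / 2 by positivity)] with s hs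
            using hq0 s hs.le
        rw [this.deriv_eq, deriv_const]
      simp [dbar, hK0.fderiv_eq, this]
    · have h1 : HasFDerivAt (fun z : ℂ => ‖z‖ ^ 2) (2 • (innerSL ℝ z)) z := by
        simpa using (hasStrictFDerivAt_norm_sq z).hasFDerivAt
      have h2 := ofRealCLM.hasFDerivAt.comp z
        ((hqd (‖z‖ ^ 2)).hasDerivAt.comp_hasFDerivAt z h1)
      have h3 : HasFDerivAt (fun z : ℂ => 1 / (Real.pi * z))
          ((ContinuousLinearMap.toSpanSingleton ℂ
            (-(1 / (Real.pi * z ^ 2)) : ℂ)).restrictScalars ℝ) z := by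
        have : HasDerivAt (fun z : ℂ => 1 / (Real.pi * z)) (-(1 / (Real.pi * z ^ 2)) : ℂ) z := by
          convert! ((hasDerivAt_id z).const_mul (Real.pi : ℂ)).inv (mul_ne_zero hpi hz) using 1
          · ext w; simp
          · simp; field_simp
        exact this.hasFDerivAt.restrictScalars ℝ
      have h4 : HasFDerivAt K _ z := h2.mul h3
      rw [dbar, h4.fderiv]
      simp
      linear_combination (-(1 / 2) * (q (‖z‖ ^ 2) : ℂ) * ((z ^ 2)⁻¹ * (Real.pi : ℂ)⁻¹)) * I_sq +
        (z⁻¹ * (Real.pi : ℂ)⁻¹ * ((deriv q (‖z‖ ^ 2) : ℝ) : ℂ)) * re_add_im z +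
        ((Real.pi : ℂ)⁻¹ * ((deriv q (‖z‖ ^ 2) : ℝ) : ℂ)) * inv_mul_cancel₀ hz
  · intro z hz
    simp [K, hq1 (‖z‖ ^ 2) (by gcongr)]
  · exact (hq'.comp hns.continuous).div_const _
  · intro z
    exact div_nonneg hqm.deriv_nonneg Real.pi_pos.le
  · intro z hz
    simp only [hdq1 (‖z‖ ^ 2) (by gcongr), zero_div]
  · rw [← Complex.integral_comp_polarCoord_symm, polarCoord_target]
    have h1 : ∫ r in Ioi (0 : ℝ), 2 * r * deriv q (r ^ 2) = 1 := by
      have := integral_Ioi_of_hasDerivAt_of_nonneg (a := 0) (l := 1) (g := fun r => q (r ^ 2))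
        (g' := fun r => 2 * r * deriv q (r ^ 2)) ?_ ?_ ?_ ?_
      · rw [this]; simp [hq0 0 (by positivity)]
      · exact (hqd.continuous.comp (by fun_prop)).continuousWithinAt
      · intro r _
        convert! (hqd (r ^ 2)).hasDerivAt.comp r (hasDerivAt_pow 2 r) using 1
        simp; ring
      · intro r hr
        exact mul_nonneg (mul_nonneg zero_le_two (le_of_lt hr)) hqm.deriv_nonneg
      · refine tendsto_const_nhds.congr' ?_
        filter_upwards [eventually_ge_atTop ε] with r hr
        exact (hq1 _ (by gcongr)).symm
    calc _ = ∫ p in Ioi (0 : ℝ) ×ˢ Ioo (-Real.pi) Real.pi,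
          (2 * p.1 * deriv q (p.1 ^ 2)) * (1 / (2 * Real.pi)) := by
          congr 1 with p
          have := Real.pi_ne_zero
          simp only [norm_polarCoord_symm, sq_abs, smul_eq_mul]
          field_simp
      _ = 1 := by
          rw [Measure.volume_eq_prod, setIntegral_prod_mul
            (f := fun r => 2 * r * deriv q (r ^ 2)) (g := fun _ => 1 / (2 * Real.pi)), h1]
          simp
          rw [max_eq_left (by positivity)]
          field_simp
          norm_num

end Kernel

section Convolution

/-- Near a given point, convolving with a compactly supported function only sees a compactly
supported truncation of the kernel. -/
theorem exists_truncated_kernel {h K : ℂ → ℂ} (hs : HasCompactSupport h)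
    (hK : ContDiff ℝ 2 K) (ζ₀ : ℂ) :
    ∃ K' : ℂ → ℂ, ContDiff ℝ 2 K' ∧ HasCompactSupport K' ∧
      ((fun ζ => ∫ z, h z * K (ζ - z)) =ᶠ[nhds ζ₀]
        convolution h K' (ContinuousLinearMap.mul ℝ ℂ) volume) ∧
      ∀ z, h z ≠ 0 → fderiv ℝ K' (ζ₀ - z) = fderiv ℝ K (ζ₀ - z) := by
  obtain ⟨R, hR0, hR⟩ := hs.isCompact.isBounded.subset_ball_lt 0 0
  let χ : ContDiffBump (0 : ℂ) := ⟨‖ζ₀‖ + 1 + R, ‖ζ₀‖ + 2 + R, by positivity, by linarith⟩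
  have hχ : ∀ ζ ∈ ball ζ₀ 1, ∀ z, h z ≠ 0 → ζ - z ∈ ball (0 : ℂ) (‖ζ₀‖ + 1 + R) := by
    intro ζ hζ z hz
    have h1 : ‖z‖ < R := by simpa using hR (subset_tsupport _ hz)
    have h2 : ‖ζ - ζ₀‖ < 1 := by simpa [dist_eq_norm] using hζ
    rw [mem_ball_zero_iff]
    have := norm_sub_le ζ z
    have := norm_add_le (ζ - ζ₀) ζ₀
    rw [sub_add_cancel] at this
    linarith
  refine ⟨fun z => χ z * K z, ?_, ?_, ?_, ?_⟩
  · exact (ofRealCLM.contDiff.comp χ.contDiff).mul hK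
  · exact (χ.hasCompactSupport.comp_left (g := fun r : ℝ => (r : ℂ)) (by simp)).mul_right
  · filter_upwards [ball_mem_nhds ζ₀ one_pos] with ζ hζ
    simp only [convolution_def, ContinuousLinearMap.mul_apply']
    congr 1 with z
    by_cases hz : h z = 0
    · simp [hz]
    · rw [χ.one_of_mem_closedBall (ball_subset_closedBall (hχ ζ hζ z hz))]
      simp
  · intro z hz
    refine Filter.EventuallyEq.fderiv_eq ?_
    filter_upwards [isOpen_ball.mem_nhds (hχ ζ₀ (mem_ball_self one_pos) z hz)] with w hw
    rw [χ.one_of_mem_closedBall (ball_subset_closedBall hw)]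
    simp

theorem contDiff_integral_mul_sub {h K : ℂ → ℂ} (hh : Integrable h) (hs : HasCompactSupport h)
    (hK : ContDiff ℝ 2 K) : ContDiff ℝ 2 fun ζ => ∫ z, h z * K (ζ - z) := by
  rw [contDiff_iff_contDiffAt]
  intro ζ
  obtain ⟨K', hK', hs', heq, -⟩ := exists_truncated_kernel hs hK ζ
  exact (hs'.contDiff_convolution_right (ContinuousLinearMap.mul ℝ ℂ)
    hh.locallyIntegrable (n := 2) hK').contDiffAt.congr_of_eventuallyEq heq

theorem dbar_integral_mul_sub {h K : ℂ → ℂ} (hh : Integrable h) (hs : HasCompactSupport h)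
    (hK : ContDiff ℝ 2 K) (ζ : ℂ) :
    dbar (fun ζ => ∫ z, h z * K (ζ - z)) ζ = ∫ z, h z * dbar K (ζ - z) := by
  obtain ⟨K', hK', hs', heq, hd⟩ := exists_truncated_kernel hs hK ζ
  have hc : Continuous (fderiv ℝ K') := hK'.continuous_fderiv (by norm_num)
  have hd' : ∀ z v, h z * fderiv ℝ K' (ζ - z) v = h z * fderiv ℝ K (ζ - z) v := fun z v => by
    by_cases hz : h z = 0
    · simp [hz]
    · rw [hd z hz]
  have h1 := hs'.hasFDerivAt_convolution_right (ContinuousLinearMap.mul ℝ ℂ)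
    hh.locallyIntegrable (hK'.of_le (by norm_num)) ζ
  have h2 : ∀ v : ℂ, fderiv ℝ (fun ζ => ∫ z, h z * K (ζ - z)) ζ v =
      ∫ z, h z * fderiv ℝ K (ζ - z) v := fun v => by
    rw [heq.fderiv_eq, h1.fderiv,
      convolution_precompR_apply _ hh.locallyIntegrable (hs'.fderiv ℝ) hc]
    simp only [convolution_def, ContinuousLinearMap.mul_apply', hd']
  have h3 : ∀ v : ℂ, Integrable fun z => h z * fderiv ℝ K (ζ - z) v := fun v => by
    simp only [← hd']
    exact (hs'.fderiv_apply ℝ v).convolutionExists_right (ContinuousLinearMap.mul ℝ ℂ)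
      hh.locallyIntegrable (hc.clm_apply continuous_const) ζ
  simp only [dbar]
  rw [h2, h2, ← integral_const_mul I, ← integral_add (h3 1) ((h3 I).const_mul I),
    ← integral_const_mul]
  congr 1 with z
  ring

/-- For compactly supported functions the full gradient is controlled by `∂/∂z̄`. -/
theorem integral_norm_fderiv_sq_eq {u : ℂ → ℂ} (hu : ContDiff ℝ 2 u) (hs : HasCompactSupport u) :
    ∫ z, (‖fderiv ℝ u z 1‖ ^ 2 + ‖fderiv ℝ u z I‖ ^ 2) = 4 * ∫ z, ‖dbar u z‖ ^ 2 := by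
  let conj := starRingEnd ℂ
  let D : ℂ → ℂ → ℂ := fun v z => fderiv ℝ u z v
  have hD : ∀ v, ContDiff ℝ 1 (D v) := fun v =>
    (hu.fderiv_right (m := 1) (by norm_num)).clm_apply contDiff_const
  have hDs : ∀ v, HasCompactSupport (D v) := fun v => hs.fderiv_apply ℝ v
  let w : ℂ → ℂ := fun z => conj (u z)
  have hw : ContDiff ℝ 2 w := conjCLE.contDiff.comp hu
  have hws : HasCompactSupport w := hs.comp_left (map_zero _)
  have hwd : ∀ v z, fderiv ℝ w z v = conj (D v z) := fun v z => by
    have := (conjCLE.hasFDerivAt (x := u z)).comp z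
      (hu.differentiable (by norm_num) z).hasFDerivAt
    have := this.fderiv
    change fderiv ℝ w z = _ at this
    rw [this]; rfl
  have hI : ∀ {f : ℂ → ℂ}, Continuous f → HasCompactSupport f → Integrable f :=
    fun h1 h2 => h1.integrable_of_hasCompactSupport h2
  have parts : ∀ a b, ∫ z, D a z * conj (D b z) = - ∫ z, fderiv ℝ (D a) z b * w z := by
    intro a b
    have := integral_mul_fderiv_eq_neg_fderiv_mul_of_integrable (μ := volume) (f := D a) (g := w)
      (v := b) ?_ ?_ ?_ (fun x _ => (hD a).differentiable (by norm_num) x)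
      (fun x _ => hw.differentiable (by norm_num) x)
    · simpa only [hwd] using this
    · exact hI ((((hD a).continuous_fderiv (by norm_num)).clm_apply continuous_const).mul
        hw.continuous) hws.mul_left
    · exact hI ((hD a).continuous.mul
        ((hw.continuous_fderiv (by norm_num)).clm_apply continuous_const)) (hDs a).mul_right
    · exact hI ((hD a).continuous.mul hw.continuous) hws.mul_left
  have hsymm : ∀ z, fderiv ℝ (D 1) z I = fderiv ℝ (D I) z 1 := by
    intro z
    have hd : DifferentiableAt ℝ (fderiv ℝ u) z :=
      (hu.fderiv_right (m := 1) (by norm_num)).differentiable (by norm_num) z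
    have h1 : ∀ a b, fderiv ℝ (D a) z b = fderiv ℝ (fderiv ℝ u) z b a := fun a b => by
      have : HasFDerivAt (D a) ((fderiv ℝ (fderiv ℝ u) z).flip a) z := by
        simpa using hd.hasFDerivAt.clm_apply (hasFDerivAt_const a z)
      rw [this.fderiv]; rfl
    rw [h1, h1]
    exact (hu.contDiffAt.isSymmSndFDerivAt (by simp)).eq I 1
  have cross : ∫ z, D 1 z * conj (D I z) = ∫ z, D I z * conj (D 1 z) := by
    rw [parts, parts]; simp only [hsymm]
  have hcD : ∀ a b, Integrable fun z => D a z * conj (D b z) := fun a b =>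
    hI ((hD a).continuous.mul (continuous_conj.comp (hD b).continuous)) (hDs a).mul_right
  have key : ∫ z, ((‖D 1 z‖ ^ 2 + ‖D I z‖ ^ 2 : ℝ) : ℂ) = ∫ z, ((4 * ‖dbar u z‖ ^ 2 : ℝ) : ℂ) := by
    have h1 : ∀ z, ((4 * ‖dbar u z‖ ^ 2 : ℝ) : ℂ) =
        ((‖D 1 z‖ ^ 2 + ‖D I z‖ ^ 2 : ℝ) : ℂ) +
          ((-I) * (D 1 z * conj (D I z)) + I * (D I z * conj (D 1 z))) := by
      intro z
      have h2 : ∀ a : ℂ, ((‖a‖ ^ 2 : ℝ) : ℂ) = a * conj a := fun a => by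
        rw [mul_conj, normSq_eq_norm_sq]
      rw [ofReal_mul, h2, ofReal_add, h2, h2]
      simp only [dbar, D, conj, map_mul, map_add, conj_I, map_div₀, map_one, map_ofNat, ofReal_ofNat]
      linear_combination (-(fderiv ℝ u z I * (starRingEnd ℂ) (fderiv ℝ u z I))) * I_sq
    simp only [h1]
    rw [integral_add, integral_add ((hcD _ _).const_mul _) ((hcD _ _).const_mul _),
      integral_const_mul, integral_const_mul, cross]
    · ring
    · refine hI ?_ ?_
      · have := (hD 1).continuous; have := (hD I).continuous; fun_prop
      · have h3 : ∀ v, HasCompactSupport fun z => ‖D v z‖ ^ 2 := fun v =>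
          (hDs v).comp_left (g := fun a => ‖a‖ ^ 2) (by simp)
        exact ((h3 1).add (h3 I)).comp_left (g := fun r : ℝ => (r : ℂ)) (by simp)
    · exact ((hcD _ _).const_mul _).add ((hcD _ _).const_mul _)
  rw [integral_complex_ofReal, integral_complex_ofReal, ofReal_inj, integral_const_mul] at key
  exact key

end Convolution

section Poincare

/-- The squared length of the gradient. -/
noncomputable def gradSq (u : ℂ → ℂ) (z : ℂ) : ℝ :=
  ‖fderiv ℝ u z 1‖ ^ 2 + ‖fderiv ℝ u z I‖ ^ 2

theorem gradSq_nonneg (u : ℂ → ℂ) (z : ℂ) : 0 ≤ gradSq u z := by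
  unfold gradSq; positivity

theorem continuous_gradSq {u : ℂ → ℂ} (hu : ContDiff ℝ 2 u) : Continuous (gradSq u) := by
  have h := hu.continuous_fderiv (by norm_num)
  have h1 := h.clm_apply (continuous_const (y := (1 : ℂ)))
  have h2 := h.clm_apply (continuous_const (y := I))
  unfold gradSq
  fun_prop

theorem norm_fderiv_apply_sq_le (u : ℂ → ℂ) (z v : ℂ) :
    ‖fderiv ℝ u z v‖ ^ 2 ≤ ‖v‖ ^ 2 * gradSq u z := by
  have h1 : fderiv ℝ u z v = (v.re : ℂ) * fderiv ℝ u z 1 + (v.im : ℂ) * fderiv ℝ u z I := by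
    conv_lhs => rw [← re_add_im v]
    have h2 : (v.re : ℂ) + v.im * I = v.re • (1 : ℂ) + v.im • I := by simp
    rw [h2, map_add, map_smul, map_smul]
    simp
  have h3 : ‖fderiv ℝ u z v‖ ≤ |v.re| * ‖fderiv ℝ u z 1‖ + |v.im| * ‖fderiv ℝ u z I‖ := by
    rw [h1]
    refine (norm_add_le _ _).trans (le_of_eq ?_)
    simp
  have h4 : ‖v‖ ^ 2 = |v.re| ^ 2 + |v.im| ^ 2 := by
    rw [← normSq_eq_norm_sq, normSq_apply, sq_abs, sq_abs]; ring
  rw [h4]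
  unfold gradSq
  refine (pow_le_pow_left₀ (norm_nonneg _) h3 2).trans ?_
  nlinarith [sq_nonneg (|v.re| * ‖fderiv ℝ u z I‖ - |v.im| * ‖fderiv ℝ u z 1‖)]

theorem sq_intervalIntegral_le {φ : ℝ → ℝ} (hφ : Continuous φ) {a b : ℝ} (hab : a < b) :
    (∫ t in a..b, φ t) ^ 2 ≤ (b - a) * ∫ t in a..b, φ t ^ 2 := by
  have hba : 0 < b - a := sub_pos.2 hab
  set A := ∫ t in a..b, φ t with hA
  have h0 : 0 ≤ ∫ t in a..b, (φ t - A / (b - a)) ^ 2 :=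
    intervalIntegral.integral_nonneg hab.le fun t _ => sq_nonneg _
  have h1 : ∫ t in a..b, (φ t - A / (b - a)) ^ 2 =
      (∫ t in a..b, φ t ^ 2) - 2 * (A / (b - a)) * A + (b - a) * (A / (b - a)) ^ 2 := by
    have : ∀ t, (φ t - A / (b - a)) ^ 2 =
        φ t ^ 2 - 2 * (A / (b - a)) * φ t + (A / (b - a)) ^ 2 := fun t => by ring
    simp only [this]
    rw [intervalIntegral.integral_add, intervalIntegral.integral_sub,
      intervalIntegral.integral_const_mul, intervalIntegral.integral_const, smul_eq_mul]
    all_goals exact Continuous.intervalIntegrable (by fun_prop) _ _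
  rw [h1] at h0
  have h2 : (∫ t in a..b, φ t ^ 2) - 2 * (A / (b - a)) * A + (b - a) * (A / (b - a)) ^ 2 =
      (∫ t in a..b, φ t ^ 2) - A ^ 2 / (b - a) := by
    field_simp; ring
  rw [h2, sub_nonneg, div_le_iff₀ hba] at h0
  linarith

/-- A function with a zero on a circle is controlled there by its gradient on the circle. -/
theorem norm_sq_le_integral_gradSq_circle {u : ℂ → ℂ} (hu : ContDiff ℝ 2 u) (c : ℂ) (s : ℝ)
    {θ₀ θ₁ : ℝ} (h₀ : θ₀ ∈ Icc (-Real.pi) Real.pi) (h₁ : θ₁ ∈ Icc (-Real.pi) Real.pi)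
    (hz : u (circleMap c s θ₀) = 0) :
    ‖u (circleMap c s θ₁)‖ ^ 2 ≤
      2 * Real.pi * s ^ 2 * ∫ θ in -Real.pi..Real.pi, gradSq u (circleMap c s θ) := by
  have hpi : -Real.pi < Real.pi := by linarith [Real.pi_pos]
  have hcm := continuous_circleMap c s
  have hcm0 := continuous_circleMap 0 s
  have hdu := hu.continuous_fderiv (by norm_num)
  let F' : ℝ → ℂ := fun θ => fderiv ℝ u (circleMap c s θ) (circleMap 0 s θ * I)
  have hF' : Continuous F' := (hdu.comp hcm).clm_apply (hcm0.mul continuous_const)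
  have hF : ∀ θ, HasDerivAt (fun θ => u (circleMap c s θ)) (F' θ) θ := fun θ =>
    (hu.differentiable (by norm_num) _).hasFDerivAt.comp_hasDerivAt θ (hasDerivAt_circleMap c s θ)
  have h1 : ∫ θ in θ₀..θ₁, F' θ = u (circleMap c s θ₁) := by
    rw [intervalIntegral.integral_eq_sub_of_hasDerivAt (fun θ _ => hF θ)
      (hF'.intervalIntegrable _ _), hz, sub_zero]
  have h2 : ‖u (circleMap c s θ₁)‖ ≤ ∫ θ in -Real.pi..Real.pi, ‖F' θ‖ := by
    rw [← h1]
    refine intervalIntegral.norm_integral_le_abs_integral_norm.trans ?_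
    rw [intervalIntegral.abs_integral_eq_abs_integral_uIoc, intervalIntegral.integral_of_le hpi.le,
      abs_of_nonneg (integral_nonneg fun _ => norm_nonneg _)]
    refine setIntegral_mono_set (hF'.norm.integrableOn_Ioc) (ae_of_all _ fun _ => norm_nonneg _)
      (LE.le.eventuallyLE ?_)
    intro θ hθ
    rw [mem_uIoc] at hθ
    rcases hθ with h | h
    · exact ⟨h₀.1.trans_lt h.1, h.2.trans h₁.2⟩
    · exact ⟨h₁.1.trans_lt h.1, h.2.trans h₀.2⟩
  have h3 := sq_intervalIntegral_le hF'.norm hpi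
  have h4 : ∫ θ in -Real.pi..Real.pi, ‖F' θ‖ ^ 2 ≤
      ∫ θ in -Real.pi..Real.pi, s ^ 2 * gradSq u (circleMap c s θ) := by
    refine intervalIntegral.integral_mono_on hpi.le ((hF'.norm.pow 2).intervalIntegrable _ _)
      (Continuous.intervalIntegrable ?_ _ _) fun θ _ => ?_
    · exact continuous_const.mul ((continuous_gradSq hu).comp hcm)
    · refine (norm_fderiv_apply_sq_le u _ _).trans (le_of_eq ?_)
      simp
  rw [intervalIntegral.integral_const_mul] at h4
  calc ‖u (circleMap c s θ₁)‖ ^ 2 ≤ (∫ θ in -Real.pi..Real.pi, ‖F' θ‖) ^ 2 := by gcongr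
    _ ≤ (Real.pi - -Real.pi) * ∫ θ in -Real.pi..Real.pi, ‖F' θ‖ ^ 2 := h3
    _ ≤ (Real.pi - -Real.pi) *
        (s ^ 2 * ∫ θ in -Real.pi..Real.pi, gradSq u (circleMap c s θ)) :=
      mul_le_mul_of_nonneg_left h4 (by linarith)
    _ = _ := by ring

/-- Integration over a disc in polar coordinates. -/
theorem lintegral_ball_eq_polar {F : ℂ → ENNReal} (hF : Measurable F) (c : ℂ) (R : ℝ) :
    ∫⁻ z in ball c R, F z = ∫⁻ r in Ioo 0 R, ENNReal.ofReal r *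
      ∫⁻ θ in Ioo (-Real.pi) Real.pi, F (circleMap c r θ) := by
  rw [← lintegral_indicator measurableSet_ball,
    ← lintegral_add_left_eq_self _ c, ← Complex.lintegral_comp_polarCoord_symm, polarCoord_target,
    Measure.volume_eq_prod, ← Measure.prod_restrict]
  have hcm : ∀ p : ℝ × ℝ, c + Complex.polarCoord.symm p = circleMap c p.1 p.2 := fun p => by
    rw [Complex.polarCoord_symm_apply, circleMap, exp_mul_I]
    simp
  have hm : Measurable fun p : ℝ × ℝ => circleMap c p.1 p.2 := by
    unfold circleMap; fun_prop
  simp only [hcm, smul_eq_mul]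
  rw [lintegral_prod _ (by
    exact ((ENNReal.measurable_ofReal.comp measurable_fst).mul
      ((hF.indicator measurableSet_ball).comp hm)).aemeasurable)]
  rw [show Ioo (0 : ℝ) R = Iio R ∩ Ioi 0 by rw [inter_comm, Ioi_inter_Iio],
    ← Measure.restrict_restrict measurableSet_Iio, ← lintegral_indicator measurableSet_Iio]
  refine setLIntegral_congr_fun measurableSet_Ioi fun r hr => ?_
  have hr : 0 < r := hr
  have hmem : ∀ θ, circleMap c r θ ∈ ball c R ↔ r < R := fun θ => by
    rw [mem_ball, dist_eq_norm, circleMap_sub_center, norm_circleMap_zero, abs_of_pos hr]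
  by_cases hrR : r < R
  · rw [indicator_of_mem (show r ∈ Iio R from hrR), ← lintegral_const_mul]
    · refine lintegral_congr fun θ => ?_
      rw [indicator_of_mem ((hmem θ).2 hrR)]
    · exact hF.comp (continuous_circleMap c r).measurable
  · rw [indicator_of_notMem (show r ∉ Iio R from hrR)]
    refine (lintegral_congr fun θ => ?_).trans lintegral_zero
    rw [indicator_of_notMem (fun h => hrR ((hmem θ).1 h)), mul_zero]

/-- Poincaré inequality on a disc for functions vanishing somewhere on each concentric circle. -/
theorem lintegral_ball_norm_sq_le {u : ℂ → ℂ} (hu : ContDiff ℝ 2 u) {c : ℂ} {R : ℝ}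
    (hz : ∀ s ∈ Ioo 0 R, ∃ z ∈ sphere c s, u z = 0) :
    ∫⁻ z in ball c R, ENNReal.ofReal (‖u z‖ ^ 2) ≤
      ENNReal.ofReal ((2 * Real.pi * R) ^ 2) * ∫⁻ z in ball c R, ENNReal.ofReal (gradSq u z) := by
  have hpi : -Real.pi ≤ Real.pi := by linarith [Real.pi_pos]
  have hE := continuous_gradSq hu
  have hm1 : Measurable fun z => ENNReal.ofReal (‖u z‖ ^ 2) :=
    (ENNReal.continuous_ofReal.comp (hu.continuous.norm.pow 2)).measurable
  have hm2 : Measurable fun z => ENNReal.ofReal (gradSq u z) :=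
    (ENNReal.continuous_ofReal.comp hE).measurable
  rw [lintegral_ball_eq_polar hm1, lintegral_ball_eq_polar hm2,
    ← lintegral_const_mul' _ _ ENNReal.ofReal_ne_top]
  refine setLIntegral_mono' measurableSet_Ioo fun r hr => ?_
  rw [mul_left_comm]
  gcongr
  obtain ⟨z, hzs, hz0⟩ := hz r hr
  have hcmE : Continuous fun θ => gradSq u (circleMap c r θ) := hE.comp (continuous_circleMap c r)
  obtain ⟨θ₀, hθ₀, rfl⟩ : ∃ θ₀ ∈ Icc (-Real.pi) Real.pi, circleMap c r θ₀ = z := by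
    refine ⟨arg (z - c), ⟨(neg_pi_lt_arg _).le, arg_le_pi _⟩, ?_⟩
    have h1 : ‖z - c‖ = r := by simpa [dist_eq_norm] using hzs
    have := norm_mul_exp_arg_mul_I (z - c)
    rw [h1] at this
    rw [circleMap, this]; ring
  set A := ∫ θ in -Real.pi..Real.pi, gradSq u (circleMap c r θ) with hA
  have hA0 : 0 ≤ A := intervalIntegral.integral_nonneg hpi fun _ _ => gradSq_nonneg _ _
  have h2 : ENNReal.ofReal A =
      ∫⁻ θ in Ioo (-Real.pi) Real.pi, ENNReal.ofReal (gradSq u (circleMap c r θ)) := by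
    rw [hA, intervalIntegral.integral_of_le hpi, integral_Ioc_eq_integral_Ioo,
      ofReal_integral_eq_lintegral_ofReal]
    · exact hcmE.integrableOn_Ioc.mono_set Ioo_subset_Ioc_self
    · exact ae_of_all _ fun _ => gradSq_nonneg _ _
  rw [← h2, ← ENNReal.ofReal_mul (by positivity)]
  calc ∫⁻ θ in Ioo (-Real.pi) Real.pi, ENNReal.ofReal (‖u (circleMap c r θ)‖ ^ 2)
      ≤ ∫⁻ θ in Ioo (-Real.pi) Real.pi, ENNReal.ofReal (2 * Real.pi * r ^ 2 * A) :=
        setLIntegral_mono' measurableSet_Ioo fun θ hθ => ENNReal.ofReal_le_ofReal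
          (norm_sq_le_integral_gradSq_circle hu c r hθ₀ (Ioo_subset_Icc_self hθ) hz0)
    _ = ENNReal.ofReal (2 * Real.pi * r ^ 2 * A * (2 * Real.pi)) := by
        rw [setLIntegral_const, Real.volume_Ioo, ← ENNReal.ofReal_mul (by
          have := Real.pi_pos; positivity)]
        congr 1; ring
    _ ≤ ENNReal.ofReal ((2 * Real.pi * R) ^ 2 * A) := by
        refine ENNReal.ofReal_le_ofReal ?_
        have : r ^ 2 ≤ R ^ 2 := pow_le_pow_left₀ hr.1.le hr.2.le 2
        have h3 : 0 ≤ (2 * Real.pi) ^ 2 * A := by positivity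
        nlinarith [mul_le_mul_of_nonneg_right this h3]

/-- Local integral inequalities on discs of fixed radius sum up to a global one. -/
theorem lintegral_le_of_forall_ball {f e : ℂ → ENNReal} (hf : Measurable f) (he : Measurable e)
    {S : Set ℂ} (hS : MeasurableSet S) {C : ENNReal} (hC : C ≠ ⊤) (r R : ℝ)
    (h : ∀ q, ∀ z ∈ S, dist z q < r → ∫⁻ z in ball q r, f z ≤ C * ∫⁻ z in ball q R, e z) :
    volume (ball (0 : ℂ) r) * ∫⁻ z in S, f z ≤ C * (volume (ball (0 : ℂ) R) * ∫⁻ z, e z) := by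
  have swap : ∀ {k : ℂ → ENNReal} (_ : Measurable k) (s : ℝ),
      ∫⁻ q, ∫⁻ z in ball q s, k z = volume (ball (0 : ℂ) s) * ∫⁻ z, k z := by
    intro k hk s
    have hm : MeasurableSet {p : ℂ × ℂ | dist p.2 p.1 < s} :=
      measurableSet_lt (measurable_snd.dist measurable_fst) measurable_const
    have h1 : ∀ q, ∫⁻ z in ball q s, k z =
        ∫⁻ z, {p : ℂ × ℂ | dist p.2 p.1 < s}.indicator (fun p => k p.2) (q, z) := fun q => by
      rw [← lintegral_indicator measurableSet_ball]
      rfl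
    simp only [h1]
    rw [lintegral_lintegral_swap (by
      exact ((hk.comp measurable_snd).indicator hm).aemeasurable), ← lintegral_const_mul _ hk]
    refine lintegral_congr fun z => ?_
    have h2 : (fun q => {p : ℂ × ℂ | dist p.2 p.1 < s}.indicator (fun p => k p.2) (q, z)) =
        (ball z s).indicator fun _ => k z := by
      ext q
      simp only [indicator, mem_ofPred_eq, mem_ball, dist_comm q z]
    rw [h2, lintegral_indicator measurableSet_ball, setLIntegral_const, mul_comm,
      Complex.volume_ball, Complex.volume_ball]
  rw [← swap he, ← lintegral_indicator hS, ← swap (hf.indicator hS), ← lintegral_const_mul' _ _ hC]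
  refine lintegral_mono fun q => ?_
  by_cases hq : ∃ z ∈ S, dist z q < r
  · obtain ⟨z, hzS, hzq⟩ := hq
    exact (lintegral_mono fun _ => indicator_le_self _ _ _).trans (h q z hzS hzq)
  · push Not at hq
    rw [setLIntegral_congr_fun (g := fun _ => 0) measurableSet_ball fun z hz => ?_]
    · simp
    · exact indicator_of_notMem (fun hzS => (hq z hzS).not_gt hz) _

end Poincare

section Cutoff

/-- Smooth cutoff functions between the sublevel and superlevel sets of a Lipschitz function. -/
theorem exists_contDiff_cutoff {d : ℂ → ℝ} (hd : LipschitzWith 1 d) {δ : ℝ} (hδ : 0 < δ) :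
    ∃ χ : ℂ → ℝ, ContDiff ℝ 2 χ ∧ (∀ z, 0 ≤ χ z ∧ χ z ≤ 1) ∧ (∀ z, d z ≤ δ → χ z = 0) ∧
      (∀ z, 2 * δ ≤ d z → χ z = 1) ∧ ∀ z, ‖fderiv ℝ χ z‖ ≤ 2 / δ := by
  let p : ℂ → ℝ := fun z => max 0 (min 1 (2 / δ * d z - 5 / 2))
  have hdl : ∀ x y, |d x - d y| ≤ dist x y := fun x y => by
    simpa [Real.dist_eq] using hd.dist_le_mul x y
  have hp0 : ∀ z, 0 ≤ p z := fun z => le_max_left _ _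
  have hp1 : ∀ z, p z ≤ 1 := fun z => max_le zero_le_one (min_le_left _ _)
  have hpl : ∀ x y, |p x - p y| ≤ 2 / δ * dist x y := fun x y => by
    have h1 : |p x - p y| ≤ |(2 / δ * d x - 5 / 2) - (2 / δ * d y - 5 / 2)| := by
      refine (abs_max_sub_max_le_max _ _ _ _).trans ?_
      rw [sub_self, abs_zero]
      refine max_le (abs_nonneg _) ((abs_min_sub_min_le_max _ _ _ _).trans ?_)
      rw [sub_self, abs_zero]
      exact max_le (abs_nonneg _) le_rfl
    refine h1.trans ?_
    rw [show (2 / δ * d x - 5 / 2) - (2 / δ * d y - 5 / 2) = 2 / δ * (d x - d y) by ring, abs_mul,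
      abs_of_pos (by positivity)]
    gcongr
    exact hdl x y
  have hpc : Continuous p := by
    have := hd.continuous
    fun_prop
  let φ : ContDiffBump (0 : ℂ) := ⟨δ / 8, δ / 4, by positivity, by linarith⟩
  let χ : ℂ → ℝ := convolution (φ.normed volume) p (ContinuousLinearMap.lsmul ℝ ℝ) volume
  have hχ : ∀ x, χ x = ∫ t, φ.normed volume t * p (x - t) := fun x => by
    simp [χ, convolution_def]
  have hφ0 := φ.nonneg_normed (μ := (volume : Measure ℂ))
  have hφi := φ.integrable_normed (μ := (volume : Measure ℂ))
  have hint : ∀ x, Integrable fun t => φ.normed volume t * p (x - t) := fun x => by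
    refine (Continuous.integrable_of_hasCompactSupport ?_ φ.hasCompactSupport_normed.mul_right)
    exact φ.continuous_normed.mul (hpc.comp (by fun_prop))
  have hsub : ∀ {x₀}, ∀ x ∈ ball x₀ φ.rOut, |d x - d x₀| ≤ δ / 4 := fun {x₀} x hx =>
    (hdl _ _).trans (mem_ball.1 hx).le
  have hconst : ∀ (c : ℝ) x₀, (∀ x, |d x - d x₀| ≤ δ / 4 → p x = c) → χ x₀ = c := by
    intro c x₀ h
    have : p x₀ = c := h x₀ (by simpa using by positivity)
    rw [← this]
    exact φ.normed_convolution_eq_right fun x hx => by rw [this, h x (hsub x hx)]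
  refine ⟨χ, ?_, fun z => ⟨?_, ?_⟩, fun z hz => ?_, fun z hz => ?_, fun z => ?_⟩
  · exact φ.hasCompactSupport_normed.contDiff_convolution_left _ (n := 2) φ.contDiff_normed
      hpc.locallyIntegrable
  · rw [hχ]
    exact integral_nonneg fun t => mul_nonneg (hφ0 t) (hp0 _)
  · rw [hχ, ← φ.integral_normed (μ := volume)]
    exact integral_mono (hint z) hφi fun t => mul_le_of_le_one_right (hφ0 t) (hp1 _)
  · refine hconst 0 z fun x hx => max_eq_left ((min_le_right _ _).trans ?_)
    have := (abs_le.1 hx).2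
    rw [sub_nonpos, div_mul_eq_mul_div, div_le_iff₀ hδ]
    linarith
  · refine hconst 1 z fun x hx => ?_
    have := (abs_le.1 hx).1
    have h2 : 1 ≤ 2 / δ * d x - 5 / 2 := by
      rw [le_sub_iff_add_le, div_mul_eq_mul_div, le_div_iff₀ hδ]
      linarith
    simp only [p]
    rw [min_eq_left h2, max_eq_right zero_le_one]
  · have hL : LipschitzWith (Real.toNNReal (2 / δ)) χ := by
      refine LipschitzWith.of_dist_le_mul fun x y => ?_
      rw [Real.coe_toNNReal _ (by positivity), Real.dist_eq, hχ, hχ,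
        ← integral_sub (hint x) (hint y)]
      refine abs_integral_le_integral_abs.trans ?_
      calc ∫ t, |φ.normed volume t * p (x - t) - φ.normed volume t * p (y - t)|
          ≤ ∫ t, φ.normed volume t * (2 / δ * dist x y) := by
            refine integral_mono ((hint x).sub (hint y)).abs (hφi.mul_const _) fun t => ?_
            simp only [← mul_sub, abs_mul, abs_of_nonneg (hφ0 t)]
            refine mul_le_mul_of_nonneg_left ((hpl _ _).trans_eq ?_) (hφ0 t)
            simp
        _ = 2 / δ * dist x y := by rw [integral_mul_const, φ.integral_normed, one_mul]
    refine (norm_fderiv_le_of_lipschitz ℝ hL).trans_eq ?_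
    exact Real.coe_toNNReal _ (by positivity)

end Cutoff

section Young

/-- Convolution with a probability density does not increase the `L²` norm. -/
theorem integral_norm_sq_conv_le {h : ℂ → ℂ} {ρ : ℂ → ℝ} (hρ : Continuous ρ) (h0 : ∀ z, 0 ≤ ρ z)
    (hs : HasCompactSupport ρ) (h1 : ∫ z, ρ z = 1) (hi : Integrable h)
    (h2 : Integrable fun z => ‖h z‖ ^ 2) :
    ∫ z, ‖∫ w, h w * ρ (z - w)‖ ^ 2 ≤ ∫ z, ‖h z‖ ^ 2 := by
  obtain ⟨M, hM⟩ := hs.exists_bound_of_continuous hρ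
  have hρi : Integrable ρ := hρ.integrable_of_hasCompactSupport hs
  have hmul : ∀ {f : ℂ → ℝ} (z : ℂ), Integrable f → Integrable fun w => f w * ρ (z - w) :=
    fun z hf => hf.mul_bdd (c := M) (hρ.comp (by fun_prop)).aestronglyMeasurable
      (ae_of_all _ fun w => hM _)
  have hρz : ∀ z, ∫ w, ρ (z - w) = 1 := fun z => by rw [integral_sub_left_eq_self, h1]
  have hconv : ∀ z, convolution (fun w => ‖h w‖ ^ 2) ρ (ContinuousLinearMap.mul ℝ ℝ) volume z =
      ∫ w, ‖h w‖ ^ 2 * ρ (z - w) := fun z => by simp [convolution_def]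
  have key : ∀ z, ‖∫ w, h w * ρ (z - w)‖ ^ 2 ≤ ∫ w, ‖h w‖ ^ 2 * ρ (z - w) := fun z => by
    set A := ∫ w, ‖h w‖ * ρ (z - w) with hA
    have hle : ‖∫ w, h w * ρ (z - w)‖ ≤ A := by
      refine (norm_integral_le_integral_norm _).trans_eq (integral_congr_ae (ae_of_all _ fun w => ?_))
      simp [abs_of_nonneg (h0 _)]
    have hnn : 0 ≤ ∫ w, (‖h w‖ - A) ^ 2 * ρ (z - w) :=
      integral_nonneg fun w => mul_nonneg (sq_nonneg _) (h0 _)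
    have hexp : ∫ w, (‖h w‖ - A) ^ 2 * ρ (z - w) =
        (∫ w, ‖h w‖ ^ 2 * ρ (z - w)) - 2 * A * A + A ^ 2 := by
      have : ∀ w, (‖h w‖ - A) ^ 2 * ρ (z - w) =
          ‖h w‖ ^ 2 * ρ (z - w) - 2 * A * (‖h w‖ * ρ (z - w)) + A ^ 2 * ρ (z - w) := fun w => by
        ring
      simp only [this]
      rw [integral_add, integral_sub, integral_const_mul, integral_const_mul, hρz, mul_one]
      · exact hmul z h2
      · exact (hmul z hi.norm).const_mul _
      · exact (hmul z h2).sub ((hmul z hi.norm).const_mul _)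
      · exact (hρi.comp_sub_left z).const_mul _
    have := pow_le_pow_left₀ (norm_nonneg _) hle 2
    linarith
  calc ∫ z, ‖∫ w, h w * ρ (z - w)‖ ^ 2
      ≤ ∫ z, convolution (fun w => ‖h w‖ ^ 2) ρ (ContinuousLinearMap.mul ℝ ℝ) volume z :=
        integral_mono_of_nonneg (ae_of_all _ fun z => sq_nonneg _)
          (h2.integrable_convolution _ hρi) (ae_of_all _ fun z => (key z).trans_eq (hconv z).symm)
    _ = ∫ z, ‖h z‖ ^ 2 := by
        rw [integral_convolution _ h2 hρi, h1]
        simp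

end Young

section Exterior

/-- Smoothing a function that is continuous near a compact set approximates it uniformly there. -/
theorem exists_forall_norm_integral_mul_sub_le {h : ℂ → ℂ} (hi : Integrable h) {K : Set ℂ}
    (hK : IsCompact K) (hc : ∀ z ∈ K, ContinuousAt h z) {η : ℝ} (hη : 0 < η) :
    ∃ ε₁ > 0, ∀ ε < ε₁, ∀ ρ : ℂ → ℝ, Continuous ρ → HasCompactSupport ρ → (∀ z, 0 ≤ ρ z) →
      (∀ z, ε < ‖z‖ → ρ z = 0) → ∫ z, ρ z = 1 →
      ∀ z ∈ K, ‖(∫ w, h w * ρ (z - w)) - h z‖ ≤ η := by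
  obtain ⟨ε₁, hε₁, H⟩ := Metric.mem_uniformity_dist.1
    (hK.uniformContinuousAt_of_continuousAt h hc (Metric.dist_mem_uniformity hη))
  refine ⟨ε₁, hε₁, fun ε hε ρ hρ hs h0 hsupp h1 z hz => ?_⟩
  obtain ⟨M, hM⟩ := hs.exists_bound_of_continuous hρ
  have hρi : Integrable fun w => ρ (z - w) :=
    (hρ.integrable_of_hasCompactSupport hs).comp_sub_left z
  have hρ1 : ∫ w, ρ (z - w) = 1 := by rw [integral_sub_left_eq_self, h1]
  have hhρ : Integrable fun w => h w * ρ (z - w) :=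
    hi.mul_bdd (c := M) (by fun_prop) (ae_of_all _ fun w => by simpa using hM _)
  have hzsub : (∫ w, h w * ρ (z - w)) - h z = ∫ w, (h w * ρ (z - w) - h z * ρ (z - w)) := by
    have hcρ : Integrable fun w => h z * (ρ (z - w) : ℂ) := hρi.ofReal.const_mul _
    rw [integral_sub hhρ hcρ, integral_const_mul, integral_complex_ofReal, hρ1]
    simp
  rw [hzsub]
  calc ‖∫ w, (h w * ρ (z - w) - h z * ρ (z - w))‖ ≤ ∫ w, η * ρ (z - w) := by
        refine norm_integral_le_of_norm_le (hρi.const_mul η) (ae_of_all _ fun w => ?_)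
        rw [← sub_mul, norm_mul, norm_real, Real.norm_of_nonneg (h0 _)]
        by_cases hw : ε < ‖z - w‖
        · simp [hsupp _ hw]
        · refine mul_le_mul_of_nonneg_right ?_ (h0 _)
          have h3 : dist z w < ε₁ := by rw [dist_eq_norm]; linarith
          have h4 := H h3 hz
          rw [← dist_eq_norm, dist_comm]
          exact (show dist (h z) (h w) < η from h4).le
    _ = η := by rw [integral_const_mul, hρ1, mul_one]

/-- Uniformly over the boundary of a plane set, nearby centres can be found all of whose small
circles meet the interior of an unbounded exterior domain. -/
theorem exists_forall_sphere_ball_subset {G Ω : Set ℂ} (hG : IsBounded G) (hΩ : IsOpen Ω)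
    (hc : IsConnected Ω) {R : ℝ} (hR : ∀ z : ℂ, R ≤ ‖z‖ → z ∈ Ω) (hfr : frontier G ⊆ closure Ω)
    {δ : ℝ} (hδ : 0 < δ) :
    ∃ ε₀ > 0, ∀ y ∈ frontier G, ∃ c, dist y c < δ ∧
      ∀ s ∈ Ioo 0 (5 * δ), ∃ v ∈ sphere c s, ball v ε₀ ⊆ Ω := by
  have center : ∀ c ∈ Ω, ∃ ε₀ > 0, ∀ s ∈ Ioo 0 (5 * δ), ∃ v ∈ sphere c s, ball v ε₀ ⊆ Ω := by
    intro c hcΩ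
    set p : ℂ := ((|R| + 5 * δ + ‖c‖ : ℝ) : ℂ) with hp
    have hpn : ‖p‖ = |R| + 5 * δ + ‖c‖ := by
      rw [hp, norm_real, Real.norm_of_nonneg (by positivity)]
    have hpΩ : p ∈ Ω := hR p (by rw [hpn]; linarith [le_abs_self R, norm_nonneg c])
    obtain ⟨γ, hγ⟩ := (hΩ.isConnected_iff_isPathConnected.1 hc).joinedIn c hcΩ p hpΩ
    obtain ⟨ε₀, hε₀, hth⟩ := (isCompact_range γ.continuous).exists_thickening_subset_open hΩ
      (range_subset_iff.2 hγ)
    refine ⟨ε₀, hε₀, fun s hs => ?_⟩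
    have hd : Continuous fun t => dist (γ t) c := γ.continuous.dist continuous_const
    have h5 : 5 * δ ≤ dist p c := by
      rw [dist_eq_norm]
      linarith [norm_sub_norm_le p c, abs_nonneg R]
    obtain ⟨t, ht⟩ := mem_range_of_exists_le_of_exists_ge hd (c := s)
      ⟨0, by simpa using hs.1.le⟩ ⟨1, by simpa using hs.2.le.trans h5⟩
    refine ⟨γ t, ht, fun w hw => hth ?_⟩
    exact Metric.mem_thickening_iff.2 ⟨γ t, mem_range_self t, hw⟩
  have hcpt : IsCompact (frontier G) :=
    Metric.isCompact_of_isClosed_isBounded isClosed_frontier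
      (hG.closure.subset frontier_subset_closure)
  refine hcpt.induction_on (p := fun s => ∃ ε₀ > 0, ∀ y ∈ s, ∃ c, dist y c < δ ∧
      ∀ s ∈ Ioo 0 (5 * δ), ∃ v ∈ sphere c s, ball v ε₀ ⊆ Ω) ⟨1, one_pos, by simp⟩ ?_ ?_ ?_
  · rintro s t hst ⟨ε, hε, h⟩
    exact ⟨ε, hε, fun y hy => h y (hst hy)⟩
  · rintro s t ⟨ε, hε, h⟩ ⟨ε', hε', h'⟩
    refine ⟨min ε ε', lt_min hε hε', ?_⟩
    rintro y (hy | hy)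
    · obtain ⟨c, hyc, H⟩ := h y hy
      refine ⟨c, hyc, fun s hs => ?_⟩
      obtain ⟨v, hv, hb⟩ := H s hs
      exact ⟨v, hv, (ball_subset_ball (min_le_left _ _)).trans hb⟩
    · obtain ⟨c, hyc, H⟩ := h' y hy
      refine ⟨c, hyc, fun s hs => ?_⟩
      obtain ⟨v, hv, hb⟩ := H s hs
      exact ⟨v, hv, (ball_subset_ball (min_le_right _ _)).trans hb⟩
  · intro y hy
    obtain ⟨c, hcΩ, hyc⟩ := Metric.mem_closure_iff.1 (hfr hy) δ hδ
    obtain ⟨ε, hε, H⟩ := center c hcΩ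
    refine ⟨ball c δ, mem_nhdsWithin_of_mem_nhds (isOpen_ball.mem_nhds hyc), ε, hε, ?_⟩
    exact fun z hz => ⟨c, hz, H⟩

/-- Comparison of disc volumes in multiplicative form. -/
theorem le_mul_of_volume_ball_mul_le {δ : ℝ} (hδ : 0 < δ) {A B : ENNReal}
    (key : volume (ball (0 : ℂ) δ) * A ≤ ENNReal.ofReal ((2 * Real.pi * (5 * δ)) ^ 2) *
      (volume (ball (0 : ℂ) (9 * δ)) * B)) :
    A ≤ ENNReal.ofReal ((90 * Real.pi * δ) ^ 2) * B := by
  have hvol : volume (ball (0 : ℂ) (9 * δ)) = ENNReal.ofReal 81 * volume (ball (0 : ℂ) δ) := by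
    rw [Complex.volume_ball, Complex.volume_ball, ENNReal.ofReal_mul (by norm_num), mul_pow,
      ← ENNReal.ofReal_pow (by norm_num), mul_assoc]
    norm_num
  have hC : ENNReal.ofReal ((90 * Real.pi * δ) ^ 2) =
      ENNReal.ofReal ((2 * Real.pi * (5 * δ)) ^ 2) * ENNReal.ofReal 81 := by
    rw [← ENNReal.ofReal_mul (by positivity)]
    congr 1; ring
  have hv0 : volume (ball (0 : ℂ) δ) ≠ 0 := (measure_ball_pos _ _ hδ).ne'
  have hvt : volume (ball (0 : ℂ) δ) ≠ ⊤ := measure_ball_lt_top.ne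
  rw [hvol] at key
  rw [hC]
  refine (ENNReal.mul_le_mul_iff_right hv0 hvt).1 (key.trans_eq ?_)
  ac_rfl

/-- Poincaré inequality on the inner boundary layer of an open set, for functions vanishing
somewhere on each circle about suitable centres near the boundary. -/
theorem setIntegral_norm_sq_boundary_le {G : Set ℂ} (hG : IsOpen G) (hGu : G ≠ univ) {u : ℂ → ℂ}
    (hu : ContDiff ℝ 2 u) (hs : HasCompactSupport u) {δ : ℝ} (hδ : 0 < δ)
    (h : ∀ y ∈ frontier G, ∃ c, dist y c < δ ∧ ∀ s ∈ Ioo 0 (5 * δ), ∃ v ∈ sphere c s, u v = 0) :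
    ∫ z in {z ∈ G | infDist z Gᶜ ≤ 2 * δ}, ‖u z‖ ^ 2 ≤
      (90 * Real.pi * δ) ^ 2 * ∫ z, gradSq u z := by
  have hE := continuous_gradSq hu
  have hEs : HasCompactSupport (gradSq u) :=
    (hs.fderiv ℝ).mono fun z hz => by
      contrapose! hz
      simp only [Function.mem_support, not_not] at hz ⊢
      simp [gradSq, hz]
  have hS : MeasurableSet {z ∈ G | infDist z Gᶜ ≤ 2 * δ} :=
    hG.measurableSet.inter (measurableSet_le (continuous_infDist_pt _).measurable measurable_const)
  have hm1 : Measurable fun z => ENNReal.ofReal (‖u z‖ ^ 2) :=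
    (ENNReal.continuous_ofReal.comp (hu.continuous.norm.pow 2)).measurable
  have hm2 : Measurable fun z => ENNReal.ofReal (gradSq u z) :=
    (ENNReal.continuous_ofReal.comp hE).measurable
  have key := lintegral_le_of_forall_ball hm1 hm2 hS
    (C := ENNReal.ofReal ((2 * Real.pi * (5 * δ)) ^ 2)) ENNReal.ofReal_ne_top δ (9 * δ) (by
      rintro q z ⟨hzG, hzd⟩ hzq
      obtain ⟨y, hy, hzy⟩ := exists_mem_frontier_infDist_compl_eq_dist hzG hGu
      obtain ⟨c, hyc, hcirc⟩ := h y hy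
      have hqc : dist q c < 4 * δ := by
        have h1 := dist_triangle4 q z y c
        rw [dist_comm q z] at h1
        rw [hzy] at hzd
        linarith
      refine (lintegral_mono_set (ball_subset_ball' ?_)).trans
        ((lintegral_ball_norm_sq_le hu hcirc).trans ?_)
      · linarith
      · gcongr
        refine ball_subset_ball' ?_
        rw [dist_comm]
        linarith)
  have hkey := le_mul_of_volume_ball_mul_le hδ key
  have hEi : Integrable (gradSq u) := hE.integrable_of_hasCompactSupport hEs
  have hus : HasCompactSupport fun z => ‖u z‖ ^ 2 :=
    hs.mono fun z hz => by
      contrapose! hz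
      simp only [Function.mem_support, not_not] at hz ⊢
      simp [hz]
  have hui : Integrable fun z => ‖u z‖ ^ 2 :=
    (hu.continuous.norm.pow 2).integrable_of_hasCompactSupport hus
  rw [← ofReal_integral_eq_lintegral_ofReal hEi (ae_of_all _ (gradSq_nonneg u)),
    ← ofReal_integral_eq_lintegral_ofReal hui.integrableOn (ae_of_all _ fun _ => sq_nonneg _),
    ← ENNReal.ofReal_mul (by positivity)] at hkey
  refine (ENNReal.ofReal_le_ofReal_iff ?_).1 hkey
  exact mul_nonneg (by positivity) (integral_nonneg (gradSq_nonneg u))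

end Exterior

section Pairing

theorem dbar_mul {f g : ℂ → ℂ} {z : ℂ} (hf : DifferentiableAt ℝ f z) (hg : DifferentiableAt ℝ g z) :
    dbar (fun z => f z * g z) z = f z * dbar g z + g z * dbar f z := by
  simp only [dbar, fderiv_fun_mul hf hg, add_apply,
    smul_apply, smul_eq_mul]
  ring

theorem dbar_eq_zero {g : ℂ → ℂ} {z : ℂ} (hg : DifferentiableAt ℂ g z) : dbar g z = 0 := by
  have h1 : fderiv ℂ g z I = I * fderiv ℂ g z 1 := by
    rw [← smul_eq_mul, ← map_smul, smul_eq_mul, mul_one]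
  rw [dbar, hg.fderiv_restrictScalars ℝ, ContinuousLinearMap.coe_restrictScalars', h1, ← mul_assoc,
    I_mul_I]
  ring

theorem continuous_dbar {f : ℂ → ℂ} (hf : ContDiff ℝ 2 f) : Continuous (dbar f) := by
  have h := hf.continuous_fderiv two_ne_zero
  have h1 := h.clm_apply (continuous_const (y := (1 : ℂ)))
  have h2 := h.clm_apply (continuous_const (y := I))
  unfold dbar
  fun_prop

theorem integral_dbar_eq_zero {F : ℂ → ℂ} (hF : ContDiff ℝ 1 F) (hs : HasCompactSupport F) :
    ∫ z, dbar F z = 0 := by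
  have hi : ∀ v, Integrable fun z => fderiv ℝ F z v := fun v =>
    ((hF.continuous_fderiv one_ne_zero).clm_apply continuous_const).integrable_of_hasCompactSupport
      (hs.fderiv_apply ℝ v)
  have h0 : ∀ v, ∫ z, fderiv ℝ F z v = 0 := fun v => by
    have := integral_mul_fderiv_eq_neg_fderiv_mul_of_integrable (μ := volume)
      (f := fun _ : ℂ => (1 : ℂ)) (g := F) (v := v) (by simp) (by simpa using hi v)
      (by simpa using hF.continuous.integrable_of_hasCompactSupport hs)
      (fun _ _ => differentiableAt_const _) (fun _ _ => hF.differentiable one_ne_zero _)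
    simpa using this
  simp only [dbar]
  rw [integral_const_mul, integral_add (hi 1) ((hi I).const_mul I), integral_const_mul, h0, h0]
  simp

theorem norm_dbar_le (f : ℂ → ℂ) (z : ℂ) : ‖dbar f z‖ ≤ ‖fderiv ℝ f z‖ := by
  have h1 := (fderiv ℝ f z).le_opNorm 1
  have h2 := (fderiv ℝ f z).le_opNorm I
  have h3 := norm_add_le (fderiv ℝ f z 1) (I * fderiv ℝ f z I)
  rw [norm_mul] at h3
  rw [dbar, norm_mul]
  simp only [norm_one, norm_I, mul_one, one_mul] at h1 h2 h3
  norm_num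
  linarith

/-- Cauchy–Schwarz for real integrals. -/
theorem sq_integral_mul_le {a b : ℂ → ℝ} {μ : Measure ℂ} (haa : Integrable (fun z => a z ^ 2) μ)
    (hbb : Integrable (fun z => b z ^ 2) μ) (hab : Integrable (fun z => a z * b z) μ) :
    (∫ z, a z * b z ∂μ) ^ 2 ≤ (∫ z, a z ^ 2 ∂μ) * ∫ z, b z ^ 2 ∂μ := by
  have h : ∀ t : ℝ, 0 ≤ (∫ z, b z ^ 2 ∂μ) * (t * t) + 2 * (∫ z, a z * b z ∂μ) * t +
      ∫ z, a z ^ 2 ∂μ := fun t => by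
    have h0 : 0 ≤ ∫ z, (a z + t * b z) ^ 2 ∂μ := integral_nonneg fun z => sq_nonneg _
    have : ∀ z, (a z + t * b z) ^ 2 = a z ^ 2 + 2 * t * (a z * b z) + t ^ 2 * b z ^ 2 := fun z => by
      ring
    simp only [this] at h0
    have hab' := hab.const_mul (2 * t)
    have habs : Integrable (fun z => a z ^ 2 + 2 * t * (a z * b z)) μ := haa.add hab'
    rw [integral_add habs (hbb.const_mul _), integral_add haa hab', integral_const_mul,
      integral_const_mul] at h0
    linarith
  have := discrim_le_zero h
  rw [discrim] at this
  linarith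

/-- Integration by parts for `∂/∂z̄` against a holomorphic function, with a cutoff. -/
theorem integral_mul_dbar_eq {G : Set ℂ} (hG : IsOpen G) {g u χ : ℂ → ℂ}
    (hg : DifferentiableOn ℂ g G) (hu : ContDiff ℝ 2 u) (hχ : ContDiff ℝ 2 χ)
    (hs : HasCompactSupport χ) (hsG : tsupport χ ⊆ G) :
    ∫ z, χ z * (g z * dbar u z) = -∫ z, u z * (g z * dbar χ z) := by
  have hgc : ∀ z ∈ G, ContDiffAt ℝ 2 g z := fun z hz =>
    ((hg.contDiffOn (n := 2) hG).contDiffAt (hG.mem_nhds hz)).restrict_scalars ℝ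
  have hdiff : ∀ {f : ℂ → ℂ}, ContDiff ℝ 2 f → ∀ z, DifferentiableAt ℝ f z := fun hf z =>
    hf.differentiable two_ne_zero z
  have hχ0 : ∀ z ∉ tsupport χ, χ z = 0 := fun z hz => image_eq_zero_of_notMem_tsupport hz
  have hdχ0 : ∀ z ∉ tsupport χ, dbar χ z = 0 := fun z hz => by
    have : fderiv ℝ χ z = 0 := by
      by_contra h
      exact hz (support_fderiv_subset ℝ h)
    simp [dbar, this]
  have hcont : ∀ {f k : ℂ → ℂ}, Continuous f → Continuous k → (∀ z ∉ tsupport χ, f z = 0) →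
      Integrable fun z => f z * (g z * k z) := fun {f k} hf hk h0 => by
    refine Continuous.integrable_of_hasCompactSupport (continuous_iff_continuousAt.2 fun z => ?_)
      (HasCompactSupport.intro hs fun z hz => by simp [h0 z hz])
    by_cases hz : z ∈ tsupport χ
    · exact hf.continuousAt.mul ((hgc z (hsG hz)).continuousAt.mul hk.continuousAt)
    · refine (continuousAt_const (y := (0 : ℂ))).congr ?_
      filter_upwards [(isClosed_tsupport χ).isOpen_compl.mem_nhds hz] with w hw
      simp [h0 w hw]
  set F : ℂ → ℂ := fun z => χ z * (g z * u z) with hF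
  have hFs : tsupport F ⊆ tsupport χ := closure_mono fun z hz => by
    contrapose! hz
    simp only [Function.mem_support, not_not] at hz ⊢
    simp [hF, hz]
  have hF1 : ContDiff ℝ 1 F := contDiff_iff_contDiffAt.2 fun z => by
    by_cases hz : z ∈ tsupport χ
    · exact (hχ.contDiffAt.mul ((hgc z (hsG hz)).mul hu.contDiffAt)).of_le (by norm_num)
    · refine contDiffAt_const (c := 0) |>.congr_of_eventuallyEq ?_
      filter_upwards [(isClosed_tsupport χ).isOpen_compl.mem_nhds hz] with w hw
      simp [hF, hχ0 w hw]
  have hFc : HasCompactSupport F := hs.of_isClosed_subset (isClosed_tsupport F) hFs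
  have hdF : ∀ z, dbar F z = χ z * (g z * dbar u z) + dbar χ z * (g z * u z) := fun z => by
    by_cases hz : z ∈ tsupport χ
    · have hgz : DifferentiableAt ℂ g z := hg.differentiableAt (hG.mem_nhds (hsG hz))
      have hgu : DifferentiableAt ℝ (fun z => g z * u z) z :=
        (hgz.restrictScalars ℝ).fun_mul (hdiff hu z)
      rw [hF, dbar_mul (hdiff hχ z) hgu,
        dbar_mul (hgz.restrictScalars ℝ) (hdiff hu z), dbar_eq_zero hgz]
      ring
    · have : fderiv ℝ F z = 0 := by
        by_contra h
        exact hz (hFs (support_fderiv_subset ℝ h))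
      rw [hχ0 z hz, hdχ0 z hz, dbar, this]
      simp
  have h0 := integral_dbar_eq_zero hF1 hFc
  simp only [hdF] at h0
  rw [integral_add (hcont hχ.continuous (continuous_dbar hu) hχ0) (hcont (continuous_dbar hχ) hu.continuous hdχ0)] at h0
  rw [eq_neg_of_add_eq_zero_left h0]
  congr 1
  exact integral_congr_ae (ae_of_all _ fun z => by ring)

end Pairing

section Bergman

/-- A smoothed Cauchy transform: it vanishes where the Cauchy transform is known to vanish, and its
`∂/∂z̄` derivative is a mollification of the density. -/
theorem exists_contDiff_dbar_eq_integral {G Ω : Set ℂ} (hGm : MeasurableSet G) (hΩ : IsOpen Ω)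
    (hd : Disjoint G Ω) {R : ℝ} (hR : ∀ z : ℂ, R ≤ ‖z‖ → z ∈ Ω) {g : ℂ → ℂ}
    (hK : ∀ ζ ∉ closure G, cauchyTransform G g ζ = 0)
    (hi : Integrable (G.indicator fun z => (starRingEnd ℂ) (g z)))
    (hs : HasCompactSupport (G.indicator fun z => (starRingEnd ℂ) (g z))) {ε : ℝ} (hε : 0 < ε) :
    ∃ (u : ℂ → ℂ) (ρ : ℂ → ℝ), ContDiff ℝ 2 u ∧ HasCompactSupport u ∧
      (∀ ζ, ball ζ ε ⊆ Ω → u ζ = 0) ∧ Continuous ρ ∧ HasCompactSupport ρ ∧ (∀ z, 0 ≤ ρ z) ∧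
      (∀ z, ε < ‖z‖ → ρ z = 0) ∧ ∫ z, ρ z = 1 ∧
      ∀ ζ, dbar u ζ = ∫ w, G.indicator (fun z => (starRingEnd ℂ) (g z)) w * ρ (ζ - w) := by
  obtain ⟨K, ρ, hKc, hKρ, hKε, hρ, hρ0, hρε, hρ1⟩ := exists_smooth_cauchyKernel hε
  set h : ℂ → ℂ := G.indicator fun z => (starRingEnd ℂ) (g z) with hh
  have hzero : ∀ ζ, ball ζ ε ⊆ Ω → ∫ z, h z * K (ζ - z) = 0 := fun ζ hζ => by
    have hζΩ : ζ ∈ Ω := hζ (mem_ball_self hε)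
    have hζG : ζ ∉ closure G := fun hc =>
      Set.disjoint_left.1 (hd.closure_left hΩ) hc hζΩ
    have h1 : ∀ z, h z * K (ζ - z) =
        G.indicator (fun z => -(1 / Real.pi : ℂ) * ((starRingEnd ℂ) (g z) / (z - ζ))) z := fun z => by
      by_cases hz : z ∈ G
      · have hle : ε ≤ ‖ζ - z‖ := by
          by_contra! hlt
          exact Set.disjoint_left.1 hd hz (hζ (by rwa [mem_ball, dist_comm, dist_eq_norm]))
        rw [hh, indicator_of_mem hz, indicator_of_mem hz, hKε _ hle, ← neg_sub ζ z, div_neg]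
        have h2 : ζ - z ≠ 0 := norm_pos_iff.1 (hε.trans_le hle)
        have h3 : (Real.pi : ℂ) ≠ 0 := ofReal_ne_zero.2 Real.pi_ne_zero
        field_simp
      · rw [hh, indicator_of_notMem hz, indicator_of_notMem hz, zero_mul]
    simp only [h1]
    rw [integral_indicator hGm, integral_const_mul, neg_mul]
    exact neg_eq_zero.2 (hK ζ hζG)
  refine ⟨fun ζ => ∫ z, h z * K (ζ - z), ρ, contDiff_integral_mul_sub hi hs hKc, ?_, hzero, hρ, ?_,
    hρ0, hρε, hρ1, fun ζ => ?_⟩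
  · refine HasCompactSupport.intro (isCompact_closedBall 0 (R + ε)) fun ζ hζ => hzero ζ fun z hz => ?_
    refine hR z ?_
    rw [mem_closedBall, dist_zero_right, not_le] at hζ
    rw [mem_ball, dist_comm, dist_eq_norm] at hz
    linarith [norm_sub_norm_le ζ z]
  · refine HasCompactSupport.intro (isCompact_closedBall 0 ε) fun z hz => hρε z ?_
    simpa using hz
  · rw [dbar_integral_mul_sub hi hs hKc]
    simp only [hKρ]

/-- The mass of a Bergman function with vanishing exterior Cauchy transform is controlled by its
mass in a thin boundary layer. -/
theorem integral_norm_sq_le_boundary {G Ω : Set ℂ} (hG : IsOpen G) (hGb : IsBounded G)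
    (hΩ : IsOpen Ω) (hc : IsConnected Ω) (hd : Disjoint G Ω) {R : ℝ}
    (hR : ∀ z : ℂ, R ≤ ‖z‖ → z ∈ Ω) (hfr : frontier G ⊆ closure Ω) {g h : ℂ → ℂ}
    (hg : DifferentiableOn ℂ g G) (hK : ∀ ζ ∉ closure G, cauchyTransform G g ζ = 0)
    (hh : h = G.indicator fun z => (starRingEnd ℂ) (g z))
    (hi : Integrable h) (h2 : Integrable fun z => ‖h z‖ ^ 2) {δ : ℝ} (hδ : 0 < δ) :
    ∫ z, ‖h z‖ ^ 2 ≤ (∫ z in {z ∈ G | infDist z Gᶜ ≤ 2 * δ}, ‖h z‖ ^ 2) +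
      360 * Real.pi * √((∫ z in {z ∈ G | infDist z Gᶜ ≤ 2 * δ}, ‖h z‖ ^ 2) * ∫ z, ‖h z‖ ^ 2) := by
  have hGu : G ≠ univ := by
    rintro rfl
    exact NormedSpace.unbounded_univ ℝ ℂ hGb
  have hs : HasCompactSupport h := HasCompactSupport.intro
    (Metric.isCompact_of_isClosed_isBounded isClosed_closure hGb.closure) fun z hz => by
      rw [hh, indicator_of_notMem fun hz' => hz (subset_closure hz')]
  set S := {z ∈ G | infDist z Gᶜ ≤ 2 * δ}
  have hS : MeasurableSet S :=
    hG.measurableSet.inter (measurableSet_le (continuous_infDist_pt _).measurable measurable_const)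
  obtain ⟨χ, hχc, hχ01, hχ0, hχ1, hχd⟩ := exists_contDiff_cutoff (lipschitz_infDist_pt Gᶜ) hδ
  have hsupp : tsupport χ ⊆ {z | δ ≤ infDist z Gᶜ} :=
    closure_minimal (fun z hz => le_of_not_ge fun hle => hz (hχ0 z hle))
      (isClosed_le continuous_const (continuous_infDist_pt _))
  have hsG : tsupport χ ⊆ G := fun z hz => by
    by_contra hzG
    have h1 : δ ≤ infDist z Gᶜ := hsupp hz
    rw [infDist_zero_of_mem hzG] at h1
    linarith
  have hχs : HasCompactSupport χ :=
    Metric.isCompact_of_isClosed_isBounded (isClosed_tsupport _) (hGb.subset hsG)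
  set X : ℂ → ℂ := fun z => (χ z : ℂ) with hX
  have hXc : ContDiff ℝ 2 X := ofRealCLM.contDiff.comp hχc
  have hXsub : tsupport X ⊆ tsupport χ := closure_mono fun z hz => by
    contrapose! hz
    simp only [Function.mem_support, not_not] at hz ⊢
    simp [hX, hz]
  have hXs : HasCompactSupport X := hχs.of_isClosed_subset (isClosed_tsupport _) hXsub
  have hdX : ∀ z, ‖dbar X z‖ ≤ 2 / δ := fun z => by
    have h1 : fderiv ℝ X z = ofRealCLM.comp (fderiv ℝ χ z) :=
      (ofRealCLM.hasFDerivAt.comp z (hχc.differentiable two_ne_zero z).hasFDerivAt).fderiv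
    refine (norm_dbar_le X z).trans ?_
    rw [h1]
    refine (ContinuousLinearMap.opNorm_comp_le _ _).trans ?_
    rw [ofRealCLM_norm, one_mul]
    exact hχd z
  have hdX0 : ∀ z ∉ S, dbar X z = 0 := fun z hz => by
    by_cases hzt : z ∈ tsupport χ
    · have h1 : 2 * δ < infDist z Gᶜ := lt_of_not_ge fun hle => hz ⟨hsG hzt, hle⟩
      have h2 : X =ᶠ[nhds z] fun _ => 1 := by
        filter_upwards [(isOpen_lt continuous_const (continuous_infDist_pt _)).mem_nhds h1]
          with w hw
        simp [hX, hχ1 w (le_of_lt hw)]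
      rw [dbar, h2.fderiv_eq]
      simp
    · have : fderiv ℝ X z = 0 := by
        by_contra h
        exact hzt (hXsub (support_fderiv_subset ℝ h))
      rw [dbar, this]
      simp
  set N := ∫ z, ‖h z‖ ^ 2 with hN
  set T := ∫ z in S, ‖h z‖ ^ 2 with hT
  set J := ∫ z, χ z * ‖h z‖ ^ 2 with hJ
  have hχb : ∀ z, ‖χ z‖ ≤ 1 := fun z => by
    rw [Real.norm_of_nonneg (hχ01 z).1]
    exact (hχ01 z).2
  have hJi : Integrable fun z => χ z * ‖h z‖ ^ 2 :=
    h2.bdd_mul (c := 1) hχc.continuous.aestronglyMeasurable (ae_of_all _ hχb)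
  have hNJ : N ≤ T + J := by
    rw [hT, ← integral_indicator hS, hJ, ← integral_add (h2.indicator hS) hJi]
    refine integral_mono h2 ((h2.indicator hS).add hJi) fun z => ?_
    have h0 : 0 ≤ χ z * ‖h z‖ ^ 2 := mul_nonneg (hχ01 z).1 (sq_nonneg _)
    by_cases hzS : z ∈ S
    · simp only [indicator_of_mem hzS]
      linarith
    · simp only [indicator_of_notMem hzS, zero_add]
      by_cases hzG : z ∈ G
      · rw [hχ1 z (le_of_not_ge fun hle => hzS ⟨hzG, hle⟩), one_mul]
      · simp [hh, hzG]
  have hgh : ∀ z, X z * g z = X z * (starRingEnd ℂ) (h z) := fun z => by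
    by_cases hz : z ∈ G
    · simp [hh, hz]
    · have : χ z = 0 := image_eq_zero_of_notMem_tsupport fun h => hz (hsG h)
      simp [hX, this]
  have hhc : ∀ z ∈ tsupport χ, ContinuousAt h z := fun z hz => by
    have h1 : ContinuousAt (fun z => (starRingEnd ℂ) (g z)) z :=
      continuous_conj.continuousAt.comp
        (hg.differentiableAt (hG.mem_nhds (hsG hz))).continuousAt
    refine h1.congr ?_
    filter_upwards [hG.mem_nhds (hsG hz)] with w hw
    rw [hh, indicator_of_mem hw]
  have hM0 : 0 ≤ ∫ z, ‖h z‖ := integral_nonneg fun _ => norm_nonneg _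
  have approx : ∀ η > 0, J ≤ 360 * Real.pi * √(T * N) + η * ∫ z, ‖h z‖ := fun η hη => by
    obtain ⟨ε₀, hε₀, hcirc⟩ := exists_forall_sphere_ball_subset hGb hΩ hc hR hfr hδ
    obtain ⟨ε₁, hε₁, hunif⟩ := exists_forall_norm_integral_mul_sub_le hi hχs hhc hη
    have hmin : 0 < min ε₀ (ε₁ / 2) := lt_min hε₀ (half_pos hε₁)
    obtain ⟨u, ρ, huc, hus, hu0, hρc, hρs, hρ0, hρε, hρ1, hdu⟩ :=
      exists_contDiff_dbar_eq_integral hG.measurableSet hΩ hd hR hK (hh ▸ hi) (hh ▸ hs) hmin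
    rw [← hh] at hdu
    have hclose := hunif _ ((min_le_right _ _).trans_lt (half_lt_self hε₁)) ρ hρc hρs hρ0 hρε hρ1
    simp only [← hdu] at hclose
    have hpoin := setIntegral_norm_sq_boundary_le hG hGu huc hus hδ fun y hy => by
      obtain ⟨c, hyc, H⟩ := hcirc y hy
      refine ⟨c, hyc, fun s hs => ?_⟩
      obtain ⟨v, hv, hb⟩ := H s hs
      exact ⟨v, hv, hu0 v ((ball_subset_ball (min_le_left _ _)).trans hb)⟩
    have hgrad : ∫ z, gradSq u z ≤ 4 * N := by
      have h1 := integral_norm_fderiv_sq_eq huc hus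
      have h3 := integral_norm_sq_conv_le hρc hρ0 hρs hρ1 hi h2
      simp only [← hdu] at h3
      unfold gradSq
      linarith
    obtain ⟨B, hB⟩ := hus.exists_bound_of_continuous huc.continuous
    have huu : Integrable fun z => ‖u z‖ ^ 2 := by
      have hus2 : HasCompactSupport fun z => ‖u z‖ ^ 2 :=
        hus.mono fun z hz => by
          contrapose! hz
          simp only [Function.mem_support, not_not] at hz ⊢
          simp [hz]
      exact (huc.continuous.norm.pow 2).integrable_of_hasCompactSupport hus2
    have hhu : Integrable fun z => ‖h z‖ * ‖u z‖ :=
      hi.norm.mul_bdd (c := B) huc.continuous.norm.aestronglyMeasurable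
        (ae_of_all _ fun z => by simpa using hB z)
    have hcs : ∫ z in S, ‖h z‖ * ‖u z‖ ≤ 180 * Real.pi * δ * √(T * N) := by
      have h3 := sq_integral_mul_le (μ := volume.restrict S) h2.integrableOn huu.integrableOn
        hhu.integrableOn
      have hT0 : 0 ≤ T := integral_nonneg fun _ => sq_nonneg _
      have h4 : (∫ z in S, ‖h z‖ * ‖u z‖) ^ 2 ≤ (180 * Real.pi * δ) ^ 2 * (T * N) := by
        refine h3.trans ((mul_le_mul_of_nonneg_left hpoin hT0).trans ?_)
        have h5 : (90 * Real.pi * δ) ^ 2 * ∫ z, gradSq u z ≤ (90 * Real.pi * δ) ^ 2 * (4 * N) :=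
          mul_le_mul_of_nonneg_left hgrad (sq_nonneg _)
        exact (mul_le_mul_of_nonneg_left h5 hT0).trans_eq (by ring)
      refine (le_abs_self _).trans ((Real.abs_le_sqrt h4).trans_eq ?_)
      rw [Real.sqrt_mul (sq_nonneg _), Real.sqrt_sq (by have := Real.pi_pos; positivity)]
    have hibp := integral_mul_dbar_eq hG hg huc hXc hXs (hXsub.trans hsG)
    have hright : ‖∫ z, X z * (g z * dbar u z)‖ ≤ 360 * Real.pi * √(T * N) := by
      rw [hibp, norm_neg]
      calc ‖∫ z, u z * (g z * dbar X z)‖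
          ≤ ∫ z, S.indicator (fun z => 2 / δ * (‖h z‖ * ‖u z‖)) z := by
            refine norm_integral_le_of_norm_le ((hhu.const_mul _).indicator hS)
              (ae_of_all _ fun z => ?_)
            by_cases hz : z ∈ S
            · have : ‖h z‖ = ‖g z‖ := by simp [hh, hz.1]
              rw [indicator_of_mem hz, norm_mul, norm_mul, this]
              calc ‖u z‖ * (‖g z‖ * ‖dbar X z‖) ≤ ‖u z‖ * (‖g z‖ * (2 / δ)) := by
                    gcongr
                    exact hdX z
                _ = _ := by ring
            · rw [indicator_of_notMem hz, hdX0 z hz]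
              simp
        _ = 2 / δ * ∫ z in S, ‖h z‖ * ‖u z‖ := by rw [integral_indicator hS, integral_const_mul]
        _ ≤ 2 / δ * (180 * Real.pi * δ * √(T * N)) := by gcongr
        _ = 360 * Real.pi * √(T * N) := by
            field_simp
            ring
    have hduc : Continuous (dbar u) := continuous_dbar huc
    have hsplit : ∀ z, (χ z * ‖h z‖ ^ 2 : ℝ) - X z * (g z * dbar u z) =
        -(X z * (starRingEnd ℂ) (h z) * (dbar u z - h z)) := fun z => by
      have h3 : (starRingEnd ℂ) (h z) * h z = (‖h z‖ ^ 2 : ℝ) := by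
        rw [← normSq_eq_conj_mul_self, normSq_eq_norm_sq]
      rw [← mul_assoc (X z), hgh, ofReal_mul, ← h3]
      ring
    obtain ⟨B', hB'⟩ := (hXs.mul_right (f' := dbar u)).exists_bound_of_continuous
      (hXc.continuous.mul hduc)
    have hLi : Integrable fun z => X z * (g z * dbar u z) := by
      have h3 : Integrable fun z => (starRingEnd ℂ) (h z) * (X z * dbar u z) :=
        (conjCLE.toContinuousLinearMap.integrable_comp hi).mul_bdd (c := B')
          (hXc.continuous.mul hduc).aestronglyMeasurable (ae_of_all _ hB')
      refine h3.congr (ae_of_all _ fun z => ?_)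
      change _ = X z * (g z * dbar u z)
      rw [← mul_assoc (X z) (g z), hgh]
      ring
    have herr : ‖(J : ℂ) - ∫ z, X z * (g z * dbar u z)‖ ≤ η * ∫ z, ‖h z‖ := by
      have hJc : Integrable fun z => ((χ z * ‖h z‖ ^ 2 : ℝ) : ℂ) := hJi.ofReal
      rw [hJ, ← integral_complex_ofReal, ← integral_sub hJc hLi, ← integral_const_mul]
      refine norm_integral_le_of_norm_le (hi.norm.const_mul η) (ae_of_all _ fun z => ?_)
      rw [hsplit, norm_neg, norm_mul, norm_mul, RCLike.norm_conj]
      by_cases hz : z ∈ tsupport χ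
      · have h3 : ‖X z‖ ≤ 1 := by simpa [hX] using hχb z
        calc ‖X z‖ * ‖h z‖ * ‖dbar u z - h z‖ ≤ 1 * ‖h z‖ * η := by
              gcongr
              exact hclose z hz
          _ = _ := by ring
      · simp only [hX, image_eq_zero_of_notMem_tsupport hz]
        simp only [ofReal_zero, norm_zero, zero_mul]
        positivity
    have h3 : J ≤ ‖(J : ℂ)‖ := by
      rw [norm_real]
      exact le_abs_self J
    have h4 := norm_sub_norm_le (J : ℂ) (∫ z, X z * (g z * dbar u z))
    linarith
  have hJ2 : J ≤ 360 * Real.pi * √(T * N) := le_of_forall_pos_le_add fun e he => by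
    refine (approx (e / ((∫ z, ‖h z‖) + 1)) (by positivity)).trans ?_
    gcongr
    rw [div_mul_eq_mul_div, div_le_iff₀ (by positivity)]
    gcongr
    linarith
  linarith

end Bergman

/-- The Cauchy transform is injective on the Bergman space of a bounded Jordan domain:
if `Kg` vanishes identically on `ℂ ∖ cl(G)` then `g = 0` on `G`. -/
theorem cauchyTransform_injective (G : Set ℂ) (hG : IsJordanDomain G)
    (g : ℂ → ℂ) (hg : MemB2 G g)
    (hK : ∀ ζ ∉ closure G, cauchyTransform G g ζ = 0) :
    ∀ z ∈ G, g z = 0 := by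
  obtain ⟨hGo, hGb, Ω, hΩ, hc, hd, ⟨R, -, hR⟩, hfr⟩ := hG.exists_exterior
  obtain ⟨hgd, hg2⟩ := hg
  have hGm := hGo.measurableSet
  set h : ℂ → ℂ := G.indicator fun z => (starRingEnd ℂ) (g z) with hh
  have hnorm : (fun z => ‖h z‖ ^ 2) = G.indicator fun z => ‖g z‖ ^ 2 := by
    ext z
    by_cases hz : z ∈ G <;> simp [hh, hz]
  have h2 : Integrable fun z => ‖h z‖ ^ 2 := by
    rw [hnorm]
    exact hg2.integrable_indicator hGm
  have hi : Integrable h := by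
    refine IntegrableOn.integrable_indicator ?_ hGm
    have hm : AEStronglyMeasurable (fun z => (starRingEnd ℂ) (g z)) (volume.restrict G) :=
      (continuous_conj.comp_continuousOn hgd.continuousOn).aestronglyMeasurable hGm
    refine Integrable.mono' (g := fun z => 1 + ‖g z‖ ^ 2) ?_ hm (ae_of_all _ fun z => ?_)
    · exact (integrableOn_const hGb.measure_lt_top.ne).add hg2
    · rw [RCLike.norm_conj]
      nlinarith [sq_nonneg (‖g z‖ - 1)]
  set N := ∫ z, ‖h z‖ ^ 2 with hN
  let S : ℕ → Set ℂ := fun n => {z ∈ G | infDist z Gᶜ ≤ 2 * (1 / ((n : ℝ) + 1))}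
  have hSm : ∀ n, MeasurableSet (S n) := fun n =>
    hGm.inter (measurableSet_le (continuous_infDist_pt _).measurable measurable_const)
  have hSanti : Antitone S := fun m n hmn z hz =>
    ⟨hz.1, hz.2.trans (mul_le_mul_of_nonneg_left (Nat.one_div_le_one_div hmn) zero_le_two)⟩
  have hSempty : ⋂ n, S n = ∅ := by
    refine eq_empty_of_forall_notMem fun z hz => ?_
    rw [mem_iInter] at hz
    have hzG : z ∈ G := (hz 0).1
    have hGc : Gᶜ.Nonempty := nonempty_compl.2 fun h => by
      rw [h] at hGb
      exact NormedSpace.unbounded_univ ℝ ℂ hGb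
    have hpos : 0 < infDist z Gᶜ :=
      (hGo.isClosed_compl.notMem_iff_infDist_pos hGc).1 (not_not.2 hzG)
    obtain ⟨n, hn⟩ := exists_nat_one_div_lt (half_pos hpos)
    have := (hz n).2
    linarith
  have hT : Tendsto (fun n => ∫ z in S n, ‖h z‖ ^ 2) atTop (nhds 0) := by
    have := tendsto_setIntegral_of_antitone hSm hSanti ⟨0, h2.integrableOn⟩
    rwa [hSempty, setIntegral_empty] at this
  have hlim : Tendsto (fun n => (∫ z in S n, ‖h z‖ ^ 2) +
      360 * Real.pi * √((∫ z in S n, ‖h z‖ ^ 2) * N)) atTop (nhds 0) := by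
    have := hT.add (((hT.mul_const N).sqrt).const_mul (360 * Real.pi))
    simpa using this
  have hN0 : N ≤ 0 := ge_of_tendsto' hlim fun n =>
    integral_norm_sq_le_boundary hGo hGb hΩ hc hd hR hfr hgd hK hh hi h2 Nat.one_div_pos_of_nat
  have hNz : ∫ z in G, ‖g z‖ ^ 2 = 0 := by
    have h1 : N = ∫ z in G, ‖g z‖ ^ 2 := by rw [hN, hnorm, integral_indicator hGm]
    exact le_antisymm (h1 ▸ hN0) (integral_nonneg fun _ => sq_nonneg _)
  have hae := (integral_eq_zero_iff_of_nonneg (fun _ => sq_nonneg _) hg2).1 hNz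
  have heq := Measure.eqOn_open_of_ae_eq hae hGo (hgd.continuousOn.norm.pow 2) continuousOn_const
  intro z hz
  simpa using heq hz
end

section
/- Let G ⊂ ℂ be a bounded domain whose boundary has planar Lebesgue measure zero. For every g ∈ B₂(G), the Cauchy transform γ = Kg, γ(ζ) = (1/π)∬_G conj(g(z))/(z−ζ) dx dy, is holomorphic on ℂ∖cl(G), satisfies γ(ζ) → 0 as ζ → ∞, and satisfies the norm bound ∬_{ℂ∖cl(G)} |γ'(ζ)|² dξ dη ≤ ∬_G |g(z)|² dx dy. In particular K is a continuous linear operator from B₂(G) (conjugate-linearly) into B₂¹(ℂ∖cl(G)) of norm at most 1. -/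
open Complex MeasureTheory Metric Set Filter Bornology ENNReal

theorem norm_setIntegral_div_sub_pow_le {A : Set ℂ} (hA : MeasurableSet A) {F : ℂ → ℂ}
    (hF : IntegrableOn F A) {ζ : ℂ} {d : ℝ} (hd : 0 < d) (hζ : ∀ z ∈ A, d ≤ ‖z - ζ‖) (n : ℕ) :
    ‖∫ z in A, F z / (z - ζ) ^ n‖ ≤ (∫ z in A, ‖F z‖) / d ^ n := by
  rw [← integral_div]
  refine norm_integral_le_of_norm_le (hF.norm.div_const _) ?_
  filter_upwards [ae_restrict_mem hA] with z hz
  rw [norm_div, norm_pow]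
  gcongr
  exact hζ z hz

theorem exists_forall_le_norm_sub {A : Set ℂ} {ζ : ℂ} (hζ : ζ ∉ closure A) :
    ∃ ε > 0, ∀ w ∈ ball ζ ε, ∀ z ∈ A, ε ≤ ‖z - w‖ := by
  obtain ⟨ε, hε, h⟩ := Metric.isOpen_iff.1 isClosed_closure.isOpen_compl ζ hζ
  refine ⟨ε / 2, half_pos hε, fun w hw z hz => ?_⟩
  by_contra! hlt
  refine h ?_ (subset_closure hz)
  rw [mem_ball] at hw ⊢
  rw [← dist_eq_norm] at hlt
  linarith [dist_triangle z w ζ]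

theorem hasDerivAt_setIntegral_div_sub_pow {A : Set ℂ} (hA : MeasurableSet A) {F : ℂ → ℂ}
    (hF : IntegrableOn F A) {ζ : ℂ} (hζ : ζ ∉ closure A) (n : ℕ) :
    HasDerivAt (fun w => ∫ z in A, F z / (z - w) ^ n)
      (n * ∫ z in A, F z / (z - ζ) ^ (n + 1)) ζ := by
  obtain ⟨ε, hε, h⟩ := exists_forall_le_norm_sub hζ
  have hmeas : ∀ w (m : ℕ), AEStronglyMeasurable (fun z => F z / (z - w) ^ m)
      (volume.restrict A) := fun w m => by
    have h₁ : AEMeasurable F (volume.restrict A) := hF.aemeasurable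
    exact (h₁.div (by fun_prop)).aestronglyMeasurable
  rw [← integral_const_mul]
  refine (hasDerivAt_integral_of_dominated_loc_of_deriv_le
    (F' := fun w z => n * (F z / (z - w) ^ (n + 1)))
    (bound := fun z => n * (‖F z‖ / ε ^ (n + 1))) (ball_mem_nhds ζ hε)
    (Eventually.of_forall fun w => hmeas w n) ?_ ((hmeas ζ _).const_mul _) ?_
    ((hF.norm.div_const _).const_mul _) ?_).2
  · refine (hF.norm.div_const (ε ^ n)).mono' (hmeas ζ n) ?_
    filter_upwards [ae_restrict_mem hA] with z hz
    rw [norm_div, norm_pow]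
    gcongr
    exact h ζ (mem_ball_self hε) z hz
  · filter_upwards [ae_restrict_mem hA] with z hz w hw
    rw [norm_mul, norm_div, norm_pow, Complex.norm_natCast]
    gcongr
    exact h w hw z hz
  · filter_upwards [ae_restrict_mem hA] with z hz w hw
    have hne : z - w ≠ 0 := norm_pos_iff.1 (hε.trans_le (h w hw z hz))
    have h₁ : HasDerivAt (fun w => (z - w) ^ n) (n * (z - w) ^ (n - 1) * (-1)) w :=
      ((hasDerivAt_id w).const_sub z).pow n
    refine ((hasDerivAt_const w (F z)).div h₁ (pow_ne_zero n hne)).congr_deriv ?_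
    rcases n with _ | n
    · simp
    · simp only [Nat.add_sub_cancel]
      field_simp
      ring

theorem isBigO_setIntegral_div_sub_pow {A : Set ℂ} (hA : MeasurableSet A)
    (hAb : Bornology.IsBounded A) {F : ℂ → ℂ} (hF : IntegrableOn F A) (n : ℕ) :
    (fun ζ => ∫ z in A, F z / (z - ζ) ^ n) =O[cobounded ℂ] fun ζ => (‖ζ‖⁻¹) ^ n := by
  obtain ⟨R, hR, hAR⟩ := hAb.exists_pos_norm_le
  refine Asymptotics.IsBigO.of_bound ((∫ z in A, ‖F z‖) * 2 ^ n) ?_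
  filter_upwards [tendsto_norm_cobounded_atTop.eventually_ge_atTop (2 * R)] with ζ hζ
  have hpos : 0 < ‖ζ‖ := by linarith
  refine (norm_setIntegral_div_sub_pow_le hA hF (half_pos hpos) (fun z hz => ?_) n).trans_eq ?_
  · rw [norm_sub_rev]
    linarith [norm_sub_norm_le ζ z, hAR z hz]
  · rw [norm_pow, norm_inv, norm_norm, inv_pow, div_pow]
    field_simp

theorem Continuous.integrable_of_isBigO_norm_inv_pow {h : ℂ → ℂ} (hc : Continuous h) {k : ℕ}
    (hk : 3 ≤ k) (hO : h =O[cobounded ℂ] fun ζ => (‖ζ‖⁻¹) ^ k) : Integrable h := by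
  refine hc.locallyIntegrable.integrable_of_isBigO_cocompact
    (g := fun ζ : ℂ => (1 + ‖ζ‖) ^ (-(3 : ℝ))) ?_
    ((integrable_one_add_norm
      (by rw [Complex.finrank_real_complex]; norm_num)).integrableAtFilter _)
  rw [← Metric.cobounded_eq_cocompact]
  refine hO.trans (Asymptotics.IsBigO.of_bound (2 ^ 3) ?_)
  filter_upwards [tendsto_norm_cobounded_atTop.eventually_ge_atTop 1] with ζ hζ
  have e : (1 + ‖ζ‖) ^ (-(3 : ℝ)) = ((1 + ‖ζ‖)⁻¹) ^ 3 := by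
    rw [Real.rpow_neg (by positivity), inv_pow]
    norm_cast
  rw [e, Real.norm_of_nonneg (by positivity), Real.norm_of_nonneg (by positivity), ← mul_pow]
  calc (‖ζ‖⁻¹) ^ k ≤ (‖ζ‖⁻¹) ^ 3 :=
        pow_le_pow_of_le_one (by positivity) (inv_le_one_of_one_le₀ hζ) hk
    _ ≤ _ := by
        gcongr
        rw [← div_eq_mul_inv, le_div_iff₀ (by positivity), inv_mul_le_iff₀ (by positivity)]
        linarith

theorem integral_inv_mul_fderiv_eq {H : ℂ → ℂ} (hH : ContDiff ℝ 1 H) (hc : HasCompactSupport H) :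
    ∫ t, t⁻¹ * (fderiv ℝ H t 1 + I * fderiv ℝ H t I) = -(2 * Real.pi) * H 0 := by
  set e : ℝ → ℂ := fun θ => Real.cos θ + Real.sin θ * I with he
  have hec : Continuous e := by fun_prop
  have hnorm : ∀ p : ℝ × ℝ, ‖p.1 * e p.2‖ = |p.1| := fun p => by
    rw [← Complex.norm_polarCoord_symm p, Complex.polarCoord_symm_apply]
  set A : ℝ × ℝ → ℂ := fun p => fderiv ℝ H (p.1 * e p.2) (e p.2) with hAdef
  set B : ℝ × ℝ → ℂ := fun p => fderiv ℝ H (p.1 * e p.2) (I * e p.2) with hBdef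
  have hD : Continuous (fderiv ℝ H) := hH.continuous_fderiv one_ne_zero
  have hAc : Continuous A := by fun_prop
  have hBc : Continuous B := by fun_prop
  obtain ⟨R, hR, hsupp⟩ := (hc.fderiv ℝ).isCompact.isBounded.exists_pos_norm_le
  have hzero : ∀ p : ℝ × ℝ, R < p.1 → fderiv ℝ H (p.1 * e p.2) = 0 := fun p hp => by
    by_contra hne
    have := hsupp _ (subset_tsupport _ hne)
    rw [hnorm] at this
    linarith [le_abs_self p.1]
  have hint : ∀ C : ℝ × ℝ → ℂ, Continuous C → (∀ p, R < p.1 → C p = 0) →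
      IntegrableOn C (Ioi 0 ×ˢ Ioo (-Real.pi) Real.pi) := fun C hC h0 => by
    refine (hC.continuousOn.integrableOn_compact
      ((isCompact_Icc (a := 0) (b := R)).prod
        (isCompact_Icc (a := -Real.pi) (b := Real.pi)))).of_forall_sdiff_eq_zero
      (measurableSet_Ioi.prod measurableSet_Ioo) ?_
    rintro p ⟨⟨h1, h2⟩, h3⟩
    refine h0 p ?_
    by_contra! h4
    exact h3 ⟨⟨le_of_lt h1, h4⟩, Ioo_subset_Icc_self h2⟩
  have hAi := hint A hAc fun p hp => by simp [hAdef, hzero p hp]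
  have hBi := hint B hBc fun p hp => by simp [hBdef, hzero p hp]
  have hlin : ∀ z : ℂ, ∀ θ : ℝ, fderiv ℝ H z 1 + I * fderiv ℝ H z I =
      e θ * (fderiv ℝ H z (e θ) + I * fderiv ℝ H z (I * e θ)) := fun z θ => by
    have h1 : e θ = Real.cos θ • (1 : ℂ) + Real.sin θ • I := by simp [he]
    have h2 : I * e θ = Real.cos θ • I + (-Real.sin θ) • (1 : ℂ) := by
      simp only [he, real_smul]
      linear_combination (norm := (push_cast; ring_nf)) (Real.sin θ : ℂ) * I_sq
    rw [h2, h1, map_add, map_add, map_smul, map_smul, map_smul, map_smul]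
    simp only [real_smul]
    have h3 : (Real.cos θ : ℂ) ^ 2 + (Real.sin θ : ℂ) ^ 2 = 1 := by
      exact_mod_cast Real.cos_sq_add_sin_sq θ
    push_cast at h3 ⊢
    linear_combination (norm := (ring_nf; simp only [I_sq]; ring_nf))
      (-fderiv ℝ H z 1 - I * fderiv ℝ H z I) * h3
  rw [← Complex.integral_comp_polarCoord_symm, polarCoord_target]
  have hcongr : ∫ p in Ioi (0 : ℝ) ×ˢ Ioo (-Real.pi) Real.pi,
      p.1 • ((Complex.polarCoord.symm p)⁻¹ * (fderiv ℝ H (Complex.polarCoord.symm p) 1 +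
        I * fderiv ℝ H (Complex.polarCoord.symm p) I)) =
      ∫ p in Ioi (0 : ℝ) ×ˢ Ioo (-Real.pi) Real.pi, (A p + I * B p) := by
    refine setIntegral_congr_fun (measurableSet_Ioi.prod measurableSet_Ioo) fun p hp => ?_
    have hp1 : (p.1 : ℂ) ≠ 0 := by exact_mod_cast (ne_of_gt hp.1 : p.1 ≠ 0)
    have hpe : e p.2 ≠ 0 := by
      intro h0
      have := hnorm (1, p.2)
      simp [h0] at this
    simp only [Complex.polarCoord_symm_apply]
    change p.1 • ((p.1 * e p.2)⁻¹ * _) = _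
    rw [hlin _ p.2, real_smul]
    simp only [hAdef, hBdef]
    simp only [he] at hpe ⊢
    field_simp
  rw [hcongr, integral_add hAi (hBi.const_mul I), integral_const_mul]
  have hA : ∫ p in Ioi (0 : ℝ) ×ˢ Ioo (-Real.pi) Real.pi, A p = -(2 * Real.pi) * H 0 := by
    rw [Measure.volume_eq_prod, ← setIntegral_prod_swap, setIntegral_prod]
    · have hr : ∀ θ : ℝ, ∫ r in Ioi (0 : ℝ), A (r, θ) = - H 0 := fun θ => by
        have hd : ∀ r ∈ Ici (0 : ℝ), HasDerivAt (fun r : ℝ => H (r * e θ)) (A (r, θ)) r := by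
          intro r _
          have h1 : HasDerivAt (fun r : ℝ => (r : ℂ) * e θ) (e θ) r := by
            simpa using (Complex.ofRealCLM.hasDerivAt (x := r)).mul_const (e θ)
          exact ((hH.differentiable one_ne_zero _).hasFDerivAt).comp_hasDerivAt r h1
        rw [integral_Ioi_of_hasDerivAt_of_tendsto' (m := 0) hd]
        · simp
        · refine ((hAc.comp (by fun_prop : Continuous fun r : ℝ => (r, θ))).continuousOn
            |>.integrableOn_compact (isCompact_Icc (a := 0) (b := R))).of_forall_sdiff_eq_zero measurableSet_Ioi ?_
          rintro r ⟨h1, h2⟩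
          have : R < r := by
            by_contra! h4
            exact h2 ⟨le_of_lt h1, h4⟩
          simp [hAdef, hzero (r, θ) this]
        · obtain ⟨S, hS, hHS⟩ := hc.isCompact.isBounded.exists_pos_norm_le
          refine tendsto_const_nhds.congr' ?_
          filter_upwards [eventually_gt_atTop S] with r hr
          by_contra hne
          have := hHS _ (subset_tsupport _ (Ne.symm hne))
          rw [hnorm (r, θ)] at this
          linarith [le_abs_self r]
      simp only [Prod.swap]
      simp_rw [hr]
      rw [setIntegral_const, Measure.real, Real.volume_Ioo,
        ENNReal.toReal_ofReal (by linarith [Real.pi_pos]), real_smul]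
      push_cast
      ring
    · exact hAi.swap
  have hB : ∫ p in Ioi (0 : ℝ) ×ˢ Ioo (-Real.pi) Real.pi, B p = 0 := by
    rw [Measure.volume_eq_prod, setIntegral_prod _ hBi]
    refine setIntegral_eq_zero_of_forall_eq_zero fun r hr => ?_
    have hd : ∀ θ : ℝ, HasDerivAt (fun θ : ℝ => H (r * e θ)) (r • B (r, θ)) θ := fun θ => by
      have h1 : HasDerivAt (fun θ : ℝ => (r : ℂ) * e θ) (r • (I * e θ)) θ := by
        have hcos := (Real.hasDerivAt_cos θ).ofReal_comp
        have hsin := (Real.hasDerivAt_sin θ).ofReal_comp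
        refine ((hcos.add (hsin.mul_const I)).const_mul (r : ℂ)).congr_deriv ?_
        simp only [he, real_smul]
        push_cast
        linear_combination (norm := ring_nf) (-(r : ℂ) * Complex.sin θ) * I_sq
      refine (((hH.differentiable one_ne_zero _).hasFDerivAt).comp_hasDerivAt θ h1).congr_deriv ?_
      rw [map_smul]
    have h2 := intervalIntegral.integral_eq_sub_of_hasDerivAt (a := -Real.pi) (b := Real.pi)
      (fun θ _ => hd θ)
      ((by fun_prop : Continuous fun θ : ℝ => r • B (r, θ)).intervalIntegrable _ _)
    rw [intervalIntegral.integral_smul,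
      intervalIntegral.integral_of_le (by linarith [Real.pi_pos]),
      integral_Ioc_eq_integral_Ioo] at h2
    have h3 : e (-Real.pi) = e Real.pi := by simp [he]
    rw [h3, sub_self] at h2
    exact (smul_eq_zero.1 h2).resolve_left (ne_of_gt hr)
  rw [hA, hB, mul_zero, add_zero]

theorem locallyIntegrable_inv : LocallyIntegrable (fun t : ℂ => t⁻¹) := by
  refine locallyIntegrable_of_norm_le_rpow (C := 1) (α := 1)
    (by rw [Complex.finrank_real_complex]; norm_num)
    (by rw [Complex.finrank_real_complex]; norm_num) (Eventually.of_forall fun t => ?_)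
    measurable_inv.aestronglyMeasurable
  rw [norm_inv, Real.rpow_neg_one, one_mul]

/-- The `L²` isometry property of the Beurling transform, restricted to the exterior of the
support. -/
theorem lintegral_enorm_setIntegral_div_sub_sq_le {A : Set ℂ} (hA : MeasurableSet A)
    (hAb : Bornology.IsBounded A) {F : ℂ → ℂ} (hF : ContDiff ℝ 2 F) (hc : HasCompactSupport F)
    (hFA : ∀ z ∉ A, F z = 0) :
    ∫⁻ ζ in (closure A)ᶜ, ‖(1 / Real.pi : ℂ) * ∫ z in A, F z / (z - ζ) ^ 2‖ₑ ^ 2 ≤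
      ∫⁻ z, ‖F z‖ₑ ^ 2 := by
  have hFi : IntegrableOn F A := (hF.continuous.integrable_of_hasCompactSupport hc).integrableOn
  set k : ℂ → ℂ := fun t => -(Real.pi : ℂ)⁻¹ * t⁻¹ with hk
  have hkl : LocallyIntegrable k := locallyIntegrable_inv.smul (-(Real.pi : ℂ)⁻¹)
  set L := ContinuousLinearMap.mul ℝ ℂ
  set u : ℂ → ℂ := convolution k F L volume with hu
  set v : ℂ → ℂ := fun ζ => (1 / Real.pi : ℂ) * ∫ z in A, F z / (z - ζ) ^ 2
  set w : ℂ → ℂ := fun ζ => (1 / Real.pi : ℂ) * (2 * ∫ z in A, F z / (z - ζ) ^ 3)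
  have huc : ContDiff ℝ 2 u := hc.contDiff_convolution_right L hkl hF
  have hu_eq : u = fun ζ => (1 / Real.pi : ℂ) * ∫ z in A, F z / (z - ζ) ^ 1 := by
    funext ζ
    rw [setIntegral_eq_integral_of_forall_compl_eq_zero fun z hz => by rw [hFA z hz, zero_div],
      ← integral_const_mul, hu, convolution_def,
      ← integral_sub_left_eq_self _ _ ζ]
    congr 1 with z
    change k (ζ - z) * F (ζ - (ζ - z)) = _
    rw [_root_.sub_sub_cancel, hk, ← neg_sub z ζ]
    simp only [inv_neg]
    ring
  have hu_deriv : ∀ ζ ∉ closure A, HasDerivAt u (v ζ) ζ := fun ζ hζ => by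
    rw [hu_eq]
    refine ((hasDerivAt_setIntegral_div_sub_pow hA hFi hζ 1).const_mul _).congr_deriv ?_
    rw [Nat.cast_one, one_mul]
  have hv_deriv : ∀ ζ ∉ closure A, HasDerivAt v (w ζ) ζ := fun ζ hζ =>
    (hasDerivAt_setIntegral_div_sub_pow hA hFi hζ 2).const_mul _
  set a : ℂ → ℂ := fun ζ => fderiv ℝ u ζ 1 with ha
  set b : ℂ → ℂ := fun ζ => fderiv ℝ u ζ I with hb
  set c : ℂ → ℂ := fun ζ => fderiv ℝ b ζ 1 with hcdef
  have hDu : ContDiff ℝ 1 (fderiv ℝ u) := huc.fderiv_right le_rfl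
  have hac : ContDiff ℝ 1 a := hDu.clm_apply contDiff_const
  have hbc : ContDiff ℝ 1 b := hDu.clm_apply contDiff_const
  have hcc : Continuous c := (hbc.continuous_fderiv one_ne_zero).clm_apply continuous_const
  have hsymm : ∀ ζ, fderiv ℝ a ζ I = c ζ := fun ζ => by
    have h := (huc.contDiffAt (x := ζ)).isSymmSndFDerivAt (by simp) I 1
    have hd := (hDu.differentiable one_ne_zero) ζ
    simp only [ha, hb, hcdef]
    rw [fderiv_clm_apply hd (by fun_prop), fderiv_clm_apply hd (by fun_prop)]
    simpa using h
  have ha_off : ∀ ζ ∉ closure A, a ζ = v ζ := fun ζ hζ => by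
    simp [ha, ((hu_deriv ζ hζ).hasFDerivAt.restrictScalars ℝ).fderiv]
  have hb_off : ∀ ζ ∉ closure A, b ζ = I * v ζ := fun ζ hζ => by
    simp [hb, ((hu_deriv ζ hζ).hasFDerivAt.restrictScalars ℝ).fderiv]
  have hc_off : ∀ ζ ∉ closure A, c ζ = I * w ζ := fun ζ hζ => by
    have h : b =ᶠ[nhds ζ] fun ζ => I * v ζ := by
      filter_upwards [isClosed_closure.isOpen_compl.mem_nhds hζ] with y hy using hb_off y hy
    simp [hcdef, h.fderiv_eq,
      (((hv_deriv ζ hζ).const_mul I).hasFDerivAt.restrictScalars ℝ).fderiv]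
  have hev : ∀ᶠ ζ in cobounded ℂ, ζ ∉ closure A := hAb.closure
  have hO := fun n => isBigO_setIntegral_div_sub_pow hA hAb hFi n
  have huO : u =O[cobounded ℂ] fun ζ => (‖ζ‖⁻¹) ^ 1 := by
    rw [hu_eq]
    exact (hO 1).const_mul_left _
  have hvO : v =O[cobounded ℂ] fun ζ => (‖ζ‖⁻¹) ^ 2 := (hO 2).const_mul_left _
  have hwO : w =O[cobounded ℂ] fun ζ => (‖ζ‖⁻¹) ^ 3 := ((hO 3).const_mul_left _).const_mul_left _
  have haO : a =O[cobounded ℂ] fun ζ => (‖ζ‖⁻¹) ^ 2 := hvO.congr' (by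
    filter_upwards [hev] with ζ hζ using (ha_off ζ hζ).symm) EventuallyEq.rfl
  have hbO : b =O[cobounded ℂ] fun ζ => (‖ζ‖⁻¹) ^ 2 := (hvO.const_mul_left I).congr' (by
    filter_upwards [hev] with ζ hζ using (hb_off ζ hζ).symm) EventuallyEq.rfl
  have hcO : c =O[cobounded ℂ] fun ζ => (‖ζ‖⁻¹) ^ 3 := (hwO.const_mul_left I).congr' (by
    filter_upwards [hev] with ζ hζ using (hc_off ζ hζ).symm) EventuallyEq.rfl
  have hint : ∀ {f g : ℂ → ℂ} {m n : ℕ}, Continuous f → Continuous g →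
      f =O[cobounded ℂ] (fun ζ => (‖ζ‖⁻¹) ^ m) → g =O[cobounded ℂ] (fun ζ => (‖ζ‖⁻¹) ^ n) →
      3 ≤ m + n → Integrable fun ζ => f ζ * (starRingEnd ℂ) (g ζ) := by
    intro f g m n hf hg hfO hgO hmn
    refine (hf.mul (continuous_conj.comp hg)).integrable_of_isBigO_norm_inv_pow hmn ?_
    have hgO' : (fun ζ => (starRingEnd ℂ) (g ζ)) =O[cobounded ℂ] fun ζ => (‖ζ‖⁻¹) ^ n :=
      hgO.norm_left.congr_left (fun ζ => (RCLike.norm_conj (g ζ)).symm) |>.of_norm_left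
    exact (hfO.mul hgO').congr_right fun ζ => (pow_add _ _ _).symm
  have hline : ∀ {f : ℂ → ℂ}, ContDiff ℝ 1 f → ∀ ζ y, HasLineDerivAt ℝ f (fderiv ℝ f ζ y) ζ y :=
    fun hf ζ y => ((hf.differentiable one_ne_zero) ζ).hasFDerivAt.hasLineDerivAt y
  have hline_conj : ∀ {f : ℂ → ℂ}, ContDiff ℝ 1 f → ∀ ζ y,
      HasLineDerivAt ℝ (fun ζ => (starRingEnd ℂ) (f ζ)) ((starRingEnd ℂ) (fderiv ℝ f ζ y)) ζ y :=
    fun hf ζ y => by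
      have h := conjCLE.toContinuousLinearMap.hasFDerivAt.comp ζ
        ((hf.differentiable one_ne_zero) ζ).hasFDerivAt
      exact h.hasLineDerivAt y
  have huc1 : ContDiff ℝ 1 u := huc.of_le one_le_two
  have hIab := hint hac.continuous hbc.continuous haO hbO (by norm_num)
  have hIba := hint hbc.continuous hac.continuous hbO haO (by norm_num)
  have hIuc := hint huc.continuous hcc huO hcO (by norm_num)
  have h₁ : ∫ ζ, u ζ * (starRingEnd ℂ) (c ζ) = -∫ ζ, a ζ * (starRingEnd ℂ) (b ζ) :=
    integral_bilinear_hasLineDerivAt_right_eq_neg_left_of_integrable (B := L) (v := 1) hIab hIuc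
      (hint huc.continuous hbc.continuous huO hbO (by norm_num)) (fun ζ _ => hline huc1 ζ 1)
      (fun ζ _ => hline_conj hbc ζ 1)
  have h₂ : ∫ ζ, u ζ * (starRingEnd ℂ) (c ζ) = -∫ ζ, b ζ * (starRingEnd ℂ) (a ζ) :=
    integral_bilinear_hasLineDerivAt_right_eq_neg_left_of_integrable (B := L) (v := I) hIba hIuc
      (hint huc.continuous hac.continuous huO haO (by norm_num)) (fun ζ _ => hline huc1 ζ I)
      (fun ζ _ => by rw [← hsymm]; exact hline_conj hac ζ I)
  have hdbar : ∀ ζ, a ζ + I * b ζ = -2 * F ζ := fun ζ => by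
    have hF1 : ContDiff ℝ 1 F := hF.of_le one_le_two
    have hDF : Continuous (fderiv ℝ F) := hF1.continuous_fderiv one_ne_zero
    have hfd : ∀ y, fderiv ℝ u ζ y = ∫ t, k t * fderiv ℝ F (ζ - t) y := fun y => by
      rw [(hc.hasFDerivAt_convolution_right L hkl hF1 ζ).fderiv,
        convolution_precompR_apply L hkl (hc.fderiv ℝ) hDF]
      rfl
    have hki : ∀ y, Integrable fun t => k t * fderiv ℝ F (ζ - t) y := fun y =>
      (hc.fderiv_apply ℝ y).convolutionExists_right L hkl (hDF.clm_apply continuous_const) ζ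
    have hH : ContDiff ℝ 1 fun t => F (ζ - t) := hF1.comp (contDiff_const.sub contDiff_id)
    have hHc : HasCompactSupport fun t => F (ζ - t) :=
      hc.comp_homeomorph (Homeomorph.subLeft ζ)
    have hHd : ∀ t y, fderiv ℝ (fun t => F (ζ - t)) t y = -fderiv ℝ F (ζ - t) y := fun t y => by
      have h := ((hF1.differentiable one_ne_zero) (ζ - t)).hasFDerivAt.comp t
        ((hasFDerivAt_id t).const_sub ζ)
      have h' : fderiv ℝ (fun t => F (ζ - t)) t = _ := h.fderiv
      simp [h']
    have h := integral_inv_mul_fderiv_eq hH hHc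
    simp only [hHd, sub_zero] at h
    simp only [ha, hb, hfd]
    rw [← integral_const_mul, ← integral_add (hki 1) ((hki I).const_mul I)]
    calc _ = ∫ t, (Real.pi : ℂ)⁻¹ * (t⁻¹ * (-fderiv ℝ F (ζ - t) 1 + I * -fderiv ℝ F (ζ - t) I)) := by
          congr 1 with t
          simp only [hk]
          ring
      _ = _ := by
          rw [integral_const_mul, h]
          field_simp
  set P : ℂ → ℂ := fun ζ => (a ζ - I * b ζ) / 2 with hP
  have hPP : ∀ ζ, P ζ * (starRingEnd ℂ) (P ζ) = F ζ * (starRingEnd ℂ) (F ζ) +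
      (I / 2) * (a ζ * (starRingEnd ℂ) (b ζ) - b ζ * (starRingEnd ℂ) (a ζ)) := fun ζ => by
    have h : F ζ = -(a ζ + I * b ζ) / 2 := by rw [hdbar]; ring
    rw [h]
    simp only [hP, map_div₀, map_sub, map_neg, map_add, map_mul, conj_I, map_ofNat]
    ring
  have hIFF : Integrable fun ζ => F ζ * (starRingEnd ℂ) (F ζ) :=
    (hF.continuous.mul (continuous_conj.comp hF.continuous)).integrable_of_hasCompactSupport
      hc.mul_right
  have hIPP : Integrable fun ζ => P ζ * (starRingEnd ℂ) (P ζ) := by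
    simp only [hPP]
    exact hIFF.add ((hIab.sub hIba).const_mul _)
  have hPF : ∫ ζ, P ζ * (starRingEnd ℂ) (P ζ) = ∫ ζ, F ζ * (starRingEnd ℂ) (F ζ) := by
    simp only [hPP]
    rw [integral_add hIFF (by exact (hIab.sub hIba).const_mul _), integral_const_mul,
      integral_sub hIab hIba, neg_inj.1 (h₁.symm.trans h₂), sub_self, mul_zero, add_zero]
  have hlint : ∀ f : ℂ → ℂ, Integrable (fun ζ => f ζ * (starRingEnd ℂ) (f ζ)) →
      ∫⁻ ζ, ‖f ζ‖ₑ ^ 2 = ENNReal.ofReal (∫ ζ, f ζ * (starRingEnd ℂ) (f ζ)).re := fun f hf => by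
    have hre : ∀ ζ, (f ζ * (starRingEnd ℂ) (f ζ)).re = ‖f ζ‖ ^ 2 := fun ζ => by
      rw [mul_conj, ofReal_re, normSq_eq_norm_sq]
    have h := ofReal_integral_eq_lintegral_ofReal hf.re
      (Eventually.of_forall fun ζ => by
        change 0 ≤ (f ζ * (starRingEnd ℂ) (f ζ)).re
        rw [hre]; positivity)
    rw [← RCLike.re_eq_complex_re, ← integral_re hf, h]
    congr 1 with ζ
    rw [RCLike.re_eq_complex_re, hre, ENNReal.ofReal_pow (norm_nonneg _), ofReal_norm]
  calc ∫⁻ ζ in (closure A)ᶜ, ‖v ζ‖ₑ ^ 2 = ∫⁻ ζ in (closure A)ᶜ, ‖P ζ‖ₑ ^ 2 := by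
        refine setLIntegral_congr_fun isClosed_closure.measurableSet.compl fun ζ hζ => ?_
        have : P ζ = v ζ := by
          simp only [hP]
          rw [ha_off ζ hζ, hb_off ζ hζ]
          linear_combination (-v ζ / 2) * I_sq
        simp only [this]
    _ ≤ ∫⁻ ζ, ‖P ζ‖ₑ ^ 2 := setLIntegral_le_lintegral _ _
    _ = ∫⁻ ζ, ‖F ζ‖ₑ ^ 2 := by rw [hlint P hIPP, hlint F hIFF, hPF]

/-- Smooth cutoffs exhausting an open set. -/
theorem IsOpen.exists_seq_contDiff_cutoff {G : Set ℂ} (hG : IsOpen G) :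
    ∃ χ : ℕ → ℂ → ℝ, (∀ n, ContDiff ℝ 2 (χ n)) ∧ (∀ n z, χ n z ∈ Icc (0 : ℝ) 1) ∧
      (∀ n, tsupport (χ n) ⊆ G) ∧ ∀ z ∈ G, ∀ᶠ n in atTop, χ n z = 1 := by
  obtain ⟨φ, hsupp, hφ, hrange⟩ := hG.exists_contDiff_support_eq (n := 2)
  have hφ0 : ∀ z, 0 ≤ φ z := fun z => (hrange (mem_range_self z)).1
  refine ⟨fun n z => Real.smoothTransition (n * φ z - 1),
    fun n => Real.smoothTransition.contDiff.comp
      ((contDiff_const.mul (hφ.of_le le_rfl)).sub contDiff_const),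
    fun n z => ⟨Real.smoothTransition.nonneg _, Real.smoothTransition.le_one _⟩,
    fun n => ?_, fun z hz => ?_⟩
  · have hcl : IsClosed {z | 1 ≤ n * φ z} :=
      isClosed_le continuous_const (continuous_const.mul hφ.continuous)
    refine (closure_minimal (fun z hz => ?_) hcl).trans (fun z hz => ?_)
    · by_contra hlt
      rw [mem_ofPred_eq, not_le] at hlt
      exact hz (Real.smoothTransition.zero_of_nonpos (by linarith))
    · rw [← hsupp, Function.mem_support]
      intro h0
      rw [mem_ofPred_eq, h0] at hz
      norm_num at hz
  · have hpos : 0 < φ z := lt_of_le_of_ne (hφ0 z) (Ne.symm (by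
      rw [← Function.mem_support, hsupp]; exact hz))
    filter_upwards [(tendsto_natCast_atTop_atTop (R := ℝ)).eventually_ge_atTop (2 / φ z)] with n hn
    refine Real.smoothTransition.one_of_one_le ?_
    rw [div_le_iff₀ hpos] at hn
    linarith

theorem MemB2.integrableOn_conj {G : Set ℂ} (hGo : IsOpen G) (hGb : Bornology.IsBounded G)
    {g : ℂ → ℂ} (hg : MemB2 G g) : IntegrableOn (fun z => (starRingEnd ℂ) (g z)) G := by
  have : IsFiniteMeasure (volume.restrict G) :=
    isFiniteMeasure_restrict.2 hGb.measure_lt_top.ne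
  have hmeas : AEStronglyMeasurable g (volume.restrict G) :=
    hg.1.continuousOn.aestronglyMeasurable hGo.measurableSet
  have h2 : MemLp g 2 (volume.restrict G) := (memLp_two_iff_integrable_sq_norm hmeas).2 hg.2
  have h1 : Integrable g (volume.restrict G) := h2.integrable one_le_two
  exact conjCLE.toContinuousLinearMap.integrable_comp h1

theorem lintegral_enorm_setIntegral_conj_div_sub_sq_le {G : Set ℂ} (hGo : IsOpen G)
    (hGb : Bornology.IsBounded G) {g : ℂ → ℂ} (hg : MemB2 G g) :
    ∫⁻ ζ in (closure G)ᶜ,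
        ‖(1 / Real.pi : ℂ) * ∫ z in G, (starRingEnd ℂ) (g z) / (z - ζ) ^ 2‖ₑ ^ 2 ≤
      ∫⁻ z in G, ‖g z‖ₑ ^ 2 := by
  have hGm := hGo.measurableSet
  obtain ⟨χ, hχ, hχ01, hχG, hχ1⟩ := hGo.exists_seq_contDiff_cutoff
  have hi := hg.integrableOn_conj hGo hGb
  set F : ℕ → ℂ → ℂ := fun n z => χ n z * (starRingEnd ℂ) (g z) with hFdef
  have hFG : ∀ n, ∀ z ∉ G, F n z = 0 := fun n z hz => by
    simp [hFdef, image_eq_zero_of_notMem_tsupport fun h => hz (hχG n h)]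
  have hFle : ∀ n z, ‖F n z‖ ≤ ‖g z‖ := fun n z => by
    simp only [hFdef, norm_mul, norm_real, RCLike.norm_conj, Real.norm_eq_abs]
    rw [abs_of_nonneg (hχ01 n z).1]
    exact mul_le_of_le_one_left (norm_nonneg _) (hχ01 n z).2
  have hFc : ∀ n, ContDiff ℝ 2 (F n) := fun n => contDiff_iff_contDiffAt.2 fun z => by
    by_cases hz : z ∈ tsupport (χ n)
    · have h1 : ContDiffAt ℝ 2 g z :=
        ((hg.1.contDiffOn hGo (n := 2)).contDiffAt (hGo.mem_nhds (hχG n hz))).restrict_scalars ℝ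
      exact (ofRealCLM.contDiff.comp (hχ n)).contDiffAt.mul
        (conjCLE.toContinuousLinearMap.contDiff.contDiffAt.comp z h1)
    · refine (contDiffAt_const (c := 0)).congr_of_eventuallyEq ?_
      filter_upwards [(isClosed_tsupport (χ n)).isOpen_compl.mem_nhds hz] with y hy
      simp [hFdef, image_eq_zero_of_notMem_tsupport hy]
  have hFcs : ∀ n, HasCompactSupport (F n) := fun n =>
    HasCompactSupport.of_support_subset_isCompact hGb.isCompact_closure fun z hz =>
      subset_closure (not_imp_comm.1 (hFG n z) hz)
  have hFi : ∀ n, IntegrableOn (F n) G := fun n =>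
    ((hFc n).continuous.integrable_of_hasCompactSupport (hFcs n)).integrableOn
  have hle : ∀ n, ∫⁻ ζ in (closure G)ᶜ,
      ‖(1 / Real.pi : ℂ) * ∫ z in G, F n z / (z - ζ) ^ 2‖ₑ ^ 2 ≤ ∫⁻ z in G, ‖g z‖ₑ ^ 2 := by
    intro n
    refine (lintegral_enorm_setIntegral_div_sub_sq_le hGm hGb (hFc n) (hFcs n) (hFG n)).trans ?_
    rw [← setLIntegral_eq_of_support_subset (s := G)]
    · gcongr with z
      exact enorm_le_iff_norm_le.2 (hFle n z)
    · intro z hz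
      by_contra h
      exact hz (by simp [hFG n z h])
  have hlim : ∀ ζ ∈ (closure G)ᶜ, Tendsto
      (fun n => ‖(1 / Real.pi : ℂ) * ∫ z in G, F n z / (z - ζ) ^ 2‖ₑ ^ 2) atTop
      (nhds (‖(1 / Real.pi : ℂ) * ∫ z in G, (starRingEnd ℂ) (g z) / (z - ζ) ^ 2‖ₑ ^ 2)) := by
    intro ζ hζ
    obtain ⟨ε, hε, h⟩ := exists_forall_le_norm_sub hζ
    refine (ENNReal.continuous_pow 2).continuousAt.tendsto.comp
      (((tendsto_integral_of_dominated_convergence (fun z => ‖g z‖ / ε ^ 2)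
        (fun n => ?_) ?_ (fun n => ?_) ?_).const_mul _).enorm)
    · have h₁ : AEMeasurable (F n) (volume.restrict G) := (hFi n).aemeasurable
      exact (h₁.div (by fun_prop)).aestronglyMeasurable
    · simpa using! hi.norm.div_const (ε ^ 2)
    · filter_upwards [ae_restrict_mem hGm] with z hz
      rw [norm_div, norm_pow]
      gcongr
      · exact hFle n z
      · exact h ζ (mem_ball_self hε) z hz
    · filter_upwards [ae_restrict_mem hGm] with z hz
      refine tendsto_const_nhds.congr' ?_
      filter_upwards [hχ1 z hz] with n hn
      simp [hFdef, hn]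
  calc _ = ∫⁻ ζ in (closure G)ᶜ, liminf (fun n =>
        ‖(1 / Real.pi : ℂ) * ∫ z in G, F n z / (z - ζ) ^ 2‖ₑ ^ 2) atTop :=
        setLIntegral_congr_fun isClosed_closure.measurableSet.compl fun ζ hζ =>
          (hlim ζ hζ).liminf_eq.symm
    _ ≤ liminf (fun n => ∫⁻ ζ in (closure G)ᶜ,
          ‖(1 / Real.pi : ℂ) * ∫ z in G, F n z / (z - ζ) ^ 2‖ₑ ^ 2) atTop := by
        refine lintegral_liminf_le' fun n => ?_
        have hcont : ContinuousOn (fun ζ => (1 / Real.pi : ℂ) * ∫ z in G, F n z / (z - ζ) ^ 2)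
            (closure G)ᶜ := fun ζ hζ =>
          ((hasDerivAt_setIntegral_div_sub_pow hGm (hFi n) hζ 2).const_mul
            _).continuousAt.continuousWithinAt
        exact (hcont.aemeasurable isClosed_closure.measurableSet.compl).enorm.pow_const 2
    _ ≤ _ := liminf_le_of_le (by isBoundedDefault) fun x hx => by
        obtain ⟨n, hn⟩ := hx.exists
        exact hn.trans (hle n)

/-- For a bounded domain `G` with null boundary and `g ∈ B₂(G)`, the Cauchy transform
`γ = Kg` is holomorphic on `ℂ ∖ cl(G)`, vanishes at infinity, and
`∬_{ℂ∖cl(G)} |γ'|² ≤ ∬_G |g|²`; hence `K : B₂(G) → B₂¹(ℂ∖cl(G))` has norm at most 1. -/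
theorem cauchyTransform_contractive (G : Set ℂ) (hGo : IsOpen G) (hGc : IsConnected G)
    (hGb : Bornology.IsBounded G) (hbd : volume (frontier G) = 0)
    (g : ℂ → ℂ) (hg : MemB2 G g) :
    DifferentiableOn ℂ (cauchyTransform G g) (closure G)ᶜ ∧
    Tendsto (cauchyTransform G g) (cobounded ℂ) (nhds 0) ∧
    (∫⁻ ζ in (closure G)ᶜ, (‖deriv (cauchyTransform G g) ζ‖₊ : ℝ≥0∞) ^ 2 ∂volume) ≤
      ∫⁻ z in G, (‖g z‖₊ : ℝ≥0∞) ^ 2 ∂volume := by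
  have hGm := hGo.measurableSet
  have hi := hg.integrableOn_conj hGo hGb
  have hγ : cauchyTransform G g = fun ζ =>
      (1 / Real.pi : ℂ) * ∫ z in G, (starRingEnd ℂ) (g z) / (z - ζ) ^ 1 := by
    funext ζ
    simp only [cauchyTransform, pow_one]
  have hd : ∀ ζ ∈ (closure G)ᶜ, HasDerivAt (cauchyTransform G g)
      ((1 / Real.pi : ℂ) * ∫ z in G, (starRingEnd ℂ) (g z) / (z - ζ) ^ 2) ζ := fun ζ hζ => by
    rw [hγ]
    simpa using (hasDerivAt_setIntegral_div_sub_pow hGm hi hζ 1).const_mul (1 / Real.pi : ℂ)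
  refine ⟨fun ζ hζ => (hd ζ hζ).differentiableAt.differentiableWithinAt, ?_, ?_⟩
  · rw [hγ]
    refine ((isBigO_setIntegral_div_sub_pow hGm hGb hi 1).const_mul_left _).trans_tendsto ?_
    simp only [pow_one]
    exact tendsto_norm_cobounded_atTop.inv_tendsto_atTop
  · refine le_trans (le_of_eq ?_) (lintegral_enorm_setIntegral_conj_div_sub_sq_le hGo hGb hg)
    refine setLIntegral_congr_fun isClosed_closure.measurableSet.compl fun ζ hζ => ?_
    simp only [(hd ζ hζ).deriv]
    rfl
end
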